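/- arXiv:2304.10980 — 3 statements merged into one kernel-verified Lean document; each statement's English description precedes it below -/
import Mathlib

section
/- For every ε > 0 there is a constant C(ε) such that for all reals X ≥ 2 and integers Q with 1 ≤ Q ≤ X, the number of pairs (A₁, A₂) of matrices in Γ₀(Q) of height at most X, both with nonzero lower-left entry, that do not form a ping pong pair, is at most C(ε) · X^{3+ε} / Q. -/
/-- The disk `D(A)` attached to `A ∈ SL₂(ℤ)`: center `a/c`, radius `1/|c|`. -/
def pingDisk (A : Matrix.SpecialLinearGroup (Fin 2) ℤ) : Set ℂ :=
  Metric.ball (((A.1 0 0 : ℤ) : ℂ) / ((A.1 1 0 : ℤ) : ℂ)) (1 / |((A.1 1 0 : ℤ) : ℝ)|)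

/-- `(A₁, A₂)` is a ping pong pair: the four closed disks are pairwise disjoint. -/
def IsPingPongPair (A₁ A₂ : Matrix.SpecialLinearGroup (Fin 2) ℤ) : Prop :=
  Disjoint (closure (pingDisk A₁)) (closure (pingDisk A₁⁻¹)) ∧
  Disjoint (closure (pingDisk A₁)) (closure (pingDisk A₂)) ∧
  Disjoint (closure (pingDisk A₁)) (closure (pingDisk A₂⁻¹)) ∧
  Disjoint (closure (pingDisk A₁⁻¹)) (closure (pingDisk A₂)) ∧
  Disjoint (closure (pingDisk A₁⁻¹)) (closure (pingDisk A₂⁻¹)) ∧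
  Disjoint (closure (pingDisk A₂)) (closure (pingDisk A₂⁻¹))

open Matrix Finset

/-- The divisor bound: `n` has `O(n ^ δ)` divisors for every `δ > 0`. -/
theorem exists_card_divisors_le_rpow (δ : ℝ) (hδ : 0 < δ) :
    ∃ K : ℝ, 0 < K ∧ ∀ n : ℕ, n ≠ 0 → (n.divisors.card : ℝ) ≤ K * (n : ℝ) ^ δ := by
  have hlog : 0 < Real.log 2 := Real.log_pos one_lt_two
  set K₀ : ℝ := 1 + 1 / (δ * Real.log 2) with hK₀
  have hK₀1 : 1 ≤ K₀ := le_add_of_nonneg_right (by positivity)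
  obtain ⟨N, hN⟩ := exists_nat_ge ((2 : ℝ) ^ (1 / δ))
  refine ⟨K₀ ^ N, by positivity, fun n hn => ?_⟩
  have key : ∀ p ∈ n.primeFactors, ((n.factorization p + 1 : ℕ) : ℝ) ≤
      (if p < N then K₀ else 1) * ((p : ℝ) ^ n.factorization p) ^ δ := by
    intro p hp
    have hp2 : (2 : ℝ) ≤ p := mod_cast (Nat.prime_of_mem_primeFactors hp).two_le
    set a := n.factorization p
    have hswap : ((p : ℝ) ^ a) ^ δ = ((p : ℝ) ^ δ) ^ a := by
      rw [← Real.rpow_natCast, ← Real.rpow_natCast, ← Real.rpow_mul (by positivity),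
        ← Real.rpow_mul (by positivity), mul_comm]
    have hbern : ∀ t : ℝ, 0 ≤ t → 1 + a * t ≤ (1 + t) ^ a := fun t ht =>
      one_add_mul_le_pow (by linarith) a
    rw [hswap]
    push_cast
    split_ifs with h
    · have h1 : 1 + δ * Real.log 2 ≤ (p : ℝ) ^ δ := by
        calc 1 + δ * Real.log 2 ≤ Real.exp (Real.log 2 * δ) := by
              linarith [Real.add_one_le_exp (Real.log 2 * δ)]
          _ = 2 ^ δ := by rw [Real.rpow_def_of_pos two_pos]
          _ ≤ _ := Real.rpow_le_rpow two_pos.le hp2 hδ.le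
      have h2 : 1 + a * (δ * Real.log 2) ≤ ((p : ℝ) ^ δ) ^ a :=
        (hbern _ (by positivity)).trans (pow_le_pow_left₀ (by positivity) h1 a)
      calc (a : ℝ) + 1 ≤ K₀ * (1 + a * (δ * Real.log 2)) := by
            have : K₀ * (a * (δ * Real.log 2)) = a * (δ * Real.log 2) + a := by
              rw [hK₀]; field_simp
            have : 0 ≤ a * (δ * Real.log 2) := by positivity
            nlinarith
        _ ≤ _ := by gcongr
    · have h1 : (1 : ℝ) + 1 ≤ (p : ℝ) ^ δ := by
        calc (1 : ℝ) + 1 = ((2 : ℝ) ^ (1 / δ)) ^ δ := by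
              rw [← Real.rpow_mul two_pos.le, one_div_mul_cancel hδ.ne', Real.rpow_one]; norm_num
          _ ≤ _ := Real.rpow_le_rpow (by positivity)
              (hN.trans (by exact_mod_cast not_lt.mp h)) hδ.le
      have := (hbern 1 zero_le_one).trans (pow_le_pow_left₀ (by positivity) h1 a)
      linarith
  rw [Nat.card_divisors hn, Nat.cast_prod]
  refine (Finset.prod_le_prod (fun _ _ => by positivity) key).trans ?_
  rw [Finset.prod_mul_distrib, Real.finsetProd_rpow _ _ (fun _ _ => by positivity)]
  have hfac : ∏ p ∈ n.primeFactors, (p : ℝ) ^ n.factorization p = n := by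
    exact_mod_cast congrArg (Nat.cast (R := ℝ)) (Nat.prod_factorization_pow_eq_self hn)
  rw [hfac]
  gcongr
  rw [Finset.prod_ite, Finset.prod_const, Finset.prod_const_one, mul_one]
  refine pow_le_pow_right₀ hK₀1 ?_
  calc _ ≤ (range N).card := card_le_card fun p hp => by simpa using (mem_filter.mp hp).2
    _ = N := card_range N

theorem harmonic_le_const_mul_rpow (δ : ℝ) (hδ : 0 < δ) (n : ℕ) (hn : 1 ≤ n) :
    (harmonic n : ℝ) ≤ (1 + 1 / δ) * (n : ℝ) ^ δ := by
  have h1 : (1 : ℝ) ≤ (n : ℝ) ^ δ := Real.one_le_rpow (by exact_mod_cast hn) hδ.le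
  have h2 := Real.log_le_rpow_div (x := n) (by positivity) hδ
  have h3 := harmonic_le_one_add_log n
  have : (1 + 1 / δ) * (n : ℝ) ^ δ = (n : ℝ) ^ δ + (n : ℝ) ^ δ / δ := by ring
  linarith

theorem sum_inv_abs_multiples_le (n : ℕ) (Q : ℤ) (hQ : 1 ≤ Q) :
    ∑ c ∈ (Icc (-n : ℤ) n).filter (fun c => Q ∣ c ∧ c ≠ 0), 1 / |(c : ℝ)| ≤
      2 * harmonic n / Q := by
  have hQ0 : (0 : ℝ) < Q := by exact_mod_cast hQ
  set P := (Icc (-n : ℤ) n).filter (fun c => Q ∣ c ∧ c ≠ 0)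
  have habs : ∀ c ∈ P, ∃ k : ℕ, |c| = Q * k ∧ k ∈ Icc 1 n := by
    intro c hc
    simp only [P, mem_filter, mem_Icc] at hc
    obtain ⟨⟨h1, h2⟩, hd, h0⟩ := hc
    obtain ⟨k, hk⟩ := (dvd_abs Q c).mpr hd
    have hcpos : 0 < |c| := abs_pos.mpr h0
    have hcn : |c| ≤ n := abs_le.mpr ⟨h1, h2⟩
    have hkpos : 0 < k := by
      rw [hk] at hcpos; exact pos_of_mul_pos_right hcpos (by omega)
    refine ⟨k.toNat, by rw [hk, Int.toNat_of_nonneg hkpos.le], ?_⟩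
    rw [mem_Icc]
    have : k ≤ n := by nlinarith
    omega
  have hmaps : ∀ c ∈ P, (|c| / Q).toNat ∈ Icc 1 n := by
    intro c hc
    obtain ⟨k, hk, hk'⟩ := habs c hc
    rwa [hk, Int.mul_ediv_cancel_left _ (by omega), Int.toNat_natCast]
  rw [← sum_fiberwise_of_maps_to hmaps, harmonic_eq_sum_Icc]
  push_cast
  rw [mul_sum, sum_div]
  refine sum_le_sum fun k hk => ?_
  have hk1 : (0 : ℝ) < k := by exact_mod_cast (mem_Icc.mp hk).1
  have hfib : ∀ c ∈ P.filter (fun c => (|c| / Q).toNat = k), |c| = Q * k := by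
    intro c hc
    obtain ⟨hcP, hck⟩ := mem_filter.mp hc
    obtain ⟨m, hm, -⟩ := habs c hcP
    rw [hm, Int.mul_ediv_cancel_left _ (by omega), Int.toNat_natCast] at hck
    rw [hm, hck]
  calc _ ≤ (P.filter (fun c => (|c| / Q).toNat = k)).card • (1 / ((Q : ℝ) * k)) := by
        refine sum_le_card_nsmul _ _ _ fun c hc => ?_
        have : |(c : ℝ)| = Q * k := by exact_mod_cast congrArg (Int.cast (R := ℝ)) (hfib c hc)
        rw [this]
    _ ≤ 2 • (1 / ((Q : ℝ) * k)) := by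
        refine nsmul_le_nsmul_left (by positivity) ?_
        calc _ ≤ ({(Q * k : ℤ), -(Q * k : ℤ)} : Finset ℤ).card := card_le_card fun c hc => by
              have hQk : (0 : ℤ) ≤ Q * k := by positivity
              simpa using (abs_eq hQk).mp (hfib c hc)
          _ ≤ 2 := card_le_two
    _ = _ := by rw [two_nsmul]; field_simp; norm_num

/-- The entries of `A` are bounded by `n` and its lower-left entry is nonzero. -/
def BoxedMatrix (n : ℕ) (A : SpecialLinearGroup (Fin 2) ℤ) : Prop :=
  (∀ i j, |A.1 i j| ≤ n) ∧ A.1 1 0 ≠ 0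

theorem sl_two_det (A : SpecialLinearGroup (Fin 2) ℤ) :
    A.1 0 0 * A.1 1 1 - A.1 0 1 * A.1 1 0 = 1 := by
  rw [← Matrix.det_fin_two]; exact A.2

theorem sl_two_ext_of_column {A B : SpecialLinearGroup (Fin 2) ℤ} (hc : A.1 1 0 ≠ 0)
    (h00 : A.1 0 0 = B.1 0 0) (h10 : A.1 1 0 = B.1 1 0) (h11 : A.1 1 1 = B.1 1 1) : A = B := by
  have hA := sl_two_det A
  have hB := sl_two_det B
  rw [← h00, ← h10, ← h11] at hB
  have h01 : A.1 0 1 = B.1 0 1 := mul_right_cancel₀ hc (by linarith)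
  ext i j
  fin_cases i <;> fin_cases j <;> assumption

theorem card_le_of_column_eq (s : Finset (SpecialLinearGroup (Fin 2) ℤ)) (n : ℕ) (a c : ℤ)
    (hc : c ≠ 0) (hcn : |c| ≤ n)
    (hs : ∀ A ∈ s, BoxedMatrix n A ∧ A.1 0 0 = a ∧ A.1 1 0 = c) :
    (s.card : ℝ) ≤ 4 * n * (1 / |(c : ℝ)|) := by
  have hm : 0 < |c| := abs_pos.mpr hc
  have hcard : s.card ≤ (Icc ((-n : ℤ) / |c|) ((n : ℤ) / |c|)).card := by
    refine card_le_card_of_injOn (fun A => A.1 1 1 / |c|) (fun A hA => ?_) fun A hA B hB hAB => ?_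
    · obtain ⟨⟨hbox, -⟩, -⟩ := hs A hA
      obtain ⟨h1, h2⟩ := abs_le.mp (hbox 1 1)
      simp only [coe_Icc, Set.mem_Icc]
      exact ⟨Int.ediv_le_ediv hm h1, Int.ediv_le_ediv hm h2⟩
    · obtain ⟨-, hAa, hAc⟩ := hs A hA
      obtain ⟨-, hBa, hBc⟩ := hs B hB
      have hA' := sl_two_det A
      have hB' := sl_two_det B
      rw [hAa, hAc] at hA'
      rw [hBa, hBc] at hB'
      refine sl_two_ext_of_column (hAc ▸ hc) (hAa.trans hBa.symm) (hAc.trans hBc.symm) ?_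
      have hcop : IsCoprime c a := ⟨-A.1 0 1, A.1 1 1, by linarith⟩
      have hdvd : c ∣ A.1 1 1 - B.1 1 1 :=
        hcop.dvd_of_dvd_mul_left ⟨A.1 0 1 - B.1 0 1, by linarith⟩
      have hmod : A.1 1 1 % |c| = B.1 1 1 % |c| :=
        Int.emod_eq_emod_iff_emod_sub_eq_zero.mpr
          (Int.emod_eq_zero_of_dvd ((abs_dvd _ _).mpr hdvd))
      rw [← Int.emod_add_mul_ediv (A.1 1 1) |c|, ← Int.emod_add_mul_ediv (B.1 1 1) |c|, hmod]
      exact congrArg _ (congrArg _ hAB)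
  have hmR : (0 : ℝ) < |(c : ℝ)| := by exact_mod_cast hm
  have hnm : (1 : ℝ) ≤ n * (1 / |(c : ℝ)|) := by
    rw [mul_one_div, le_div_iff₀ hmR, one_mul]; exact_mod_cast hcn
  have hlen : (s.card : ℤ) ≤ 2 * ((n : ℤ) / |c|) + 2 := by
    have hq : 0 ≤ (n : ℤ) / |c| := Int.ediv_nonneg (by positivity) hm.le
    have hneg : -((n : ℤ) / |c|) - 1 ≤ (-n : ℤ) / |c| := by
      rw [Int.le_ediv_iff_mul_le hm]
      have := Int.lt_ediv_add_one_mul_self (n : ℤ) hm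
      linarith
    have := Int.card_Icc ((-n : ℤ) / |c|) ((n : ℤ) / |c|)
    omega
  have hfl : (((n : ℤ) / |c| : ℤ) : ℝ) ≤ n * (1 / |(c : ℝ)|) := by
    rw [mul_one_div, le_div_iff₀ hmR]; exact_mod_cast Int.ediv_mul_le (n : ℤ) hm.ne'
  have : (s.card : ℝ) ≤ 2 * (((n : ℤ) / |c| : ℤ) : ℝ) + 2 := by exact_mod_cast hlen
  linarith

theorem card_le_of_column_count (s : Finset (SpecialLinearGroup (Fin 2) ℤ)) (n R : ℕ) (Q : ℤ)
    (hQ : 1 ≤ Q) (hs : ∀ A ∈ s, BoxedMatrix n A ∧ Q ∣ A.1 1 0)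
    (hR : ∀ c, ((s.filter (fun A => A.1 1 0 = c)).image (fun A => A.1 0 0)).card ≤ R) :
    (s.card : ℝ) ≤ R * (8 * n * harmonic n / Q) := by
  set P := (Icc (-n : ℤ) n).filter (fun c => Q ∣ c ∧ c ≠ 0)
  have hmaps : ∀ A ∈ s, A.1 1 0 ∈ P := by
    intro A hA
    obtain ⟨⟨hbox, h0⟩, hd⟩ := hs A hA
    simp only [P, mem_filter, mem_Icc]
    exact ⟨abs_le.mp (hbox 1 0), hd, h0⟩
  rw [card_eq_sum_card_fiberwise hmaps]
  push_cast
  calc _ ≤ ∑ c ∈ P, (R * (4 * n)) * (1 / |(c : ℝ)|) := by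
        refine sum_le_sum fun c hc => ?_
        simp only [P, mem_filter, mem_Icc] at hc
        set t := s.filter (fun A => A.1 1 0 = c)
        rw [card_eq_sum_card_image (fun A => A.1 0 0) t]
        push_cast
        calc _ ≤ (t.image (fun A => A.1 0 0)).card • (4 * n * (1 / |(c : ℝ)|)) := by
              refine sum_le_card_nsmul _ _ _ fun a _ => ?_
              refine card_le_of_column_eq _ n a c hc.2.2 (abs_le.mpr hc.1) fun A hA => ?_
              simp only [t, mem_filter] at hA
              exact ⟨(hs A hA.1.1).1, hA.2, hA.1.2⟩
          _ ≤ R • (4 * n * (1 / |(c : ℝ)|)) := nsmul_le_nsmul_left (by positivity) (hR c)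
          _ = _ := by rw [nsmul_eq_mul]; ring
    _ = (R * (4 * n)) * ∑ c ∈ P, 1 / |(c : ℝ)| := by rw [mul_sum]
    _ ≤ (R * (4 * n)) * (2 * harmonic n / Q) := by
        gcongr; exact sum_inv_abs_multiples_le n Q hQ
    _ = _ := by ring

theorem card_boxed_le (s : Finset (SpecialLinearGroup (Fin 2) ℤ)) (n : ℕ) (Q : ℤ)
    (hQ : 1 ≤ Q) (hs : ∀ A ∈ s, BoxedMatrix n A ∧ Q ∣ A.1 1 0) :
    (s.card : ℝ) ≤ (2 * n + 1) * (8 * n * harmonic n / Q) := by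
  refine (card_le_of_column_count s n (2 * n + 1) Q hQ hs fun c => ?_).trans_eq (by push_cast; ring)
  calc _ ≤ (Icc (-n : ℤ) n).card := card_le_card fun a ha => by
        simp only [mem_image, mem_filter] at ha
        obtain ⟨A, ⟨hA, -⟩, rfl⟩ := ha
        exact mem_Icc.mpr (abs_le.mp ((hs A hA).1.1 0 0))
    _ ≤ _ := by rw [Int.card_Icc]; omega

/-- The real parts of the isometric disks of `A` and `B` meet. -/
def IsoDisksMeet (A B : SpecialLinearGroup (Fin 2) ℤ) : Prop :=
  |A.1 0 0 * B.1 1 0 - B.1 0 0 * A.1 1 0| ≤ |A.1 1 0| + |B.1 1 0|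

theorem card_isoDisksMeet_le (s : Finset (SpecialLinearGroup (Fin 2) ℤ)) (n : ℕ)
    (B : SpecialLinearGroup (Fin 2) ℤ) (hB : B.1 1 0 ≠ 0)
    (hs : ∀ A ∈ s, BoxedMatrix n A ∧ |A.1 1 0| ≤ |B.1 1 0| ∧ IsoDisksMeet A B) :
    (s.card : ℝ) ≤ 40 * n * harmonic n := by
  refine (card_le_of_column_count s n 5 1 le_rfl (fun A hA => ⟨(hs A hA).1, one_dvd _⟩)
    fun c => ?_).trans_eq (by push_cast; ring)
  set t := (s.filter (fun A => A.1 1 0 = c)).image (fun A => A.1 0 0)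
  rcases t.eq_empty_or_nonempty with ht | ht
  · simp [ht]
  have hclose : ∀ a ∈ t, |a * B.1 1 0 - B.1 0 0 * c| ≤ 2 * |B.1 1 0| := by
    intro a ha
    simp only [t, mem_image, mem_filter] at ha
    obtain ⟨A, ⟨hA, rfl⟩, rfl⟩ := ha
    obtain ⟨-, h1, h2⟩ := hs A hA
    exact h2.trans (by linarith)
  have hB' : 0 < |B.1 1 0| := abs_pos.mpr hB
  have hsub : t ⊆ Icc (t.min' ht) (t.min' ht + 4) := by
    intro a ha
    refine mem_Icc.mpr ⟨min'_le _ _ ha, ?_⟩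
    have h1 := hclose a ha
    have h2 := hclose _ (t.min'_mem ht)
    have h3 : |a - t.min' ht| * |B.1 1 0| ≤ 4 * |B.1 1 0| := by
      rw [← abs_mul]
      have := abs_sub (a * B.1 1 0 - B.1 0 0 * c) (t.min' ht * B.1 1 0 - B.1 0 0 * c)
      rw [show (a - t.min' ht) * B.1 1 0 =
        (a * B.1 1 0 - B.1 0 0 * c) - (t.min' ht * B.1 1 0 - B.1 0 0 * c) by ring]
      linarith
    have h4 := le_of_mul_le_mul_right h3 hB'
    linarith [le_abs_self (a - t.min' ht)]
  calc _ ≤ _ := card_le_card hsub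
    _ = 5 := by rw [Int.card_Icc]; omega

theorem exists_card_small_trace_le (δ : ℝ) (hδ : 0 < δ) :
    ∃ K : ℝ, 0 < K ∧ ∀ (n : ℕ) (s : Finset (SpecialLinearGroup (Fin 2) ℤ)), 2 ≤ n →
      (∀ A ∈ s, BoxedMatrix n A ∧ |A.1 0 0 + A.1 1 1| ≤ 2) →
      (s.card : ℝ) ≤ K * (n * (n : ℝ) ^ δ) := by
  obtain ⟨K, hK, hdiv⟩ := exists_card_divisors_le_rpow (δ / 3) (by positivity)
  refine ⟨3 * (10 * K + 2), by positivity, fun n s hn hs => ?_⟩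
  have hnR : (2 : ℝ) ≤ n := by exact_mod_cast hn
  set s₁ := s.filter (fun A => A.1 0 0 * A.1 1 1 = 1)
  set s₂ := s.filter (fun A => ¬ A.1 0 0 * A.1 1 1 = 1)
  have hsplit : s.card = s₁.card + s₂.card := (card_filter_add_card_filter_not _).symm
  have h₁ : s₁.card ≤ 2 * (2 * n + 1) := by
    calc s₁.card ≤ (({1, -1} : Finset ℤ) ×ˢ Icc (-n : ℤ) n).card := by
          refine card_le_card_of_injOn (fun A => (A.1 0 0, A.1 1 0)) (fun A hA => ?_)
            fun A hA B hB hAB => ?_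
          · obtain ⟨hA, hA1⟩ := mem_filter.mp hA
            have hbox := abs_le.mp ((hs A hA).1.1 1 0)
            have := Int.mul_eq_one_iff_eq_one_or_neg_one.mp hA1
            simp only [coe_product, Set.mem_prod, mem_coe, mem_insert, mem_singleton, mem_Icc]
            exact ⟨this.imp And.left And.left, hbox⟩
          · obtain ⟨hA, hA1⟩ := mem_filter.mp hA
            obtain ⟨hB, hB1⟩ := mem_filter.mp hB
            obtain ⟨h00, h10⟩ := Prod.mk.inj hAB
            refine sl_two_ext_of_column (hs A hA).1.2 h00 h10 ?_
            rcases Int.mul_eq_one_iff_eq_one_or_neg_one.mp hA1 with h | h <;>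
            rcases Int.mul_eq_one_iff_eq_one_or_neg_one.mp hB1 with h' | h' <;> omega
      _ = 2 * (2 * n + 1) := by
          rw [card_product, Int.card_Icc, card_pair (by norm_num)]; omega
  have h₂ : (s₂.card : ℝ) ≤ ((2 * n + 1) * 5) * (2 * (K * (n : ℝ) ^ δ)) := by
    set T : Finset (ℤ × ℤ) := Icc (-n : ℤ) n ×ˢ Icc (-2 : ℤ) 2
    have hmaps : ∀ A ∈ s₂, (A.1 0 0, A.1 0 0 + A.1 1 1) ∈ T := by
      intro A hA
      obtain ⟨hA, -⟩ := mem_filter.mp hA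
      simp only [T, mem_product, mem_Icc]
      exact ⟨abs_le.mp ((hs A hA).1.1 0 0), abs_le.mp (hs A hA).2⟩
    have hT : (T.card : ℝ) = (2 * n + 1) * 5 := by
      have : T.card = (2 * n + 1) * 5 := by
        rw [card_product, Int.card_Icc, Int.card_Icc]
        congr 1; omega
      rw [this]; push_cast; ring
    rw [card_eq_sum_card_fiberwise hmaps]
    push_cast
    rw [← hT, ← nsmul_eq_mul]
    refine sum_le_card_nsmul _ _ _ fun x _ => ?_
    set u := s₂.filter (fun A => (A.1 0 0, A.1 0 0 + A.1 1 1) = x)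
    rcases u.eq_empty_or_nonempty with hu | ⟨A₀, hA₀⟩
    · rw [hu]; simp only [card_empty, Nat.cast_zero]; positivity
    have hu : ∀ A ∈ u, BoxedMatrix n A ∧ A.1 0 0 * A.1 1 1 ≠ 1 ∧
        A.1 0 0 = A₀.1 0 0 ∧ A.1 1 1 = A₀.1 1 1 := by
      intro A hA
      obtain ⟨hA, hAx⟩ := mem_filter.mp hA
      obtain ⟨hA, hA1⟩ := mem_filter.mp hA
      have := hAx.trans (mem_filter.mp hA₀).2.symm
      obtain ⟨h1, h2⟩ := Prod.mk.inj this
      exact ⟨(hs A hA).1, hA1, h1, by omega⟩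
    set m := (A₀.1 0 0 * A₀.1 1 1 - 1).natAbs
    obtain ⟨hbox₀, hne₀, -⟩ := hu A₀ hA₀
    have hm0 : m ≠ 0 := Int.natAbs_ne_zero.mpr (sub_ne_zero.mpr hne₀)
    have hmn : m ≤ n ^ 3 := by
      have h : (m : ℤ) ≤ n * n + 1 := by
        rw [Int.natCast_natAbs]
        refine (abs_sub _ _).trans ?_
        rw [abs_mul, abs_one]
        have := mul_le_mul (hbox₀.1 0 0) (hbox₀.1 1 1) (abs_nonneg _) (by positivity)
        linarith
      have h' : m ≤ n * n + 1 := by exact_mod_cast h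
      nlinarith [mul_le_mul hn hn (by norm_num) (by omega)]
    have hcard : u.card ≤ m.divisors.card * 2 := by
      calc u.card ≤ (m.divisors ×ˢ (univ : Finset Bool)).card := by
            refine card_le_card_of_injOn (fun A => ((A.1 1 0).natAbs, decide (0 < A.1 1 0)))
              (fun A hA => ?_) fun A hA B hB hAB => ?_
            · obtain ⟨-, -, h00, h11⟩ := hu A hA
              have hdet := sl_two_det A
              rw [h00, h11] at hdet
              simp only [coe_product, Set.mem_prod, mem_coe, Nat.mem_divisors, mem_univ, and_true]
              exact ⟨Int.natAbs_dvd_natAbs.mpr ⟨A.1 0 1, by linarith⟩, hm0⟩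
            · obtain ⟨hAb, -, hA0, hA1⟩ := hu A hA
              obtain ⟨-, -, hB0, hB1⟩ := hu B hB
              obtain ⟨h1, h2⟩ := Prod.mk.inj hAB
              have h3 : (0 < A.1 1 0 ↔ 0 < B.1 1 0) := by simpa using h2
              exact sl_two_ext_of_column hAb.2 (hA0.trans hB0.symm) (by omega)
                (hA1.trans hB1.symm)
        _ = m.divisors.card * 2 := by rw [card_product, card_univ, Fintype.card_bool]
    have hpow : (m : ℝ) ^ (δ / 3) ≤ (n : ℝ) ^ δ := by
      calc (m : ℝ) ^ (δ / 3) ≤ ((n : ℝ) ^ (3 : ℝ)) ^ (δ / 3) := by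
            refine Real.rpow_le_rpow (by positivity) ?_ (by positivity)
            exact_mod_cast hmn
        _ = (n : ℝ) ^ δ := by rw [← Real.rpow_mul (by positivity)]; congr 1; ring
    calc (u.card : ℝ) ≤ m.divisors.card * 2 := by exact_mod_cast hcard
      _ ≤ (K * (m : ℝ) ^ (δ / 3)) * 2 := by gcongr; exact hdiv m hm0
      _ ≤ (K * (n : ℝ) ^ δ) * 2 := by gcongr
      _ = _ := mul_comm _ _
  have h1 : (1 : ℝ) ≤ (n : ℝ) ^ δ := Real.one_le_rpow (by linarith) hδ.le
  have h₁' : (s₁.card : ℝ) ≤ 2 * (2 * n + 1) := by exact_mod_cast h₁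
  rw [hsplit]
  push_cast
  calc _ ≤ 2 * (2 * n + 1) * (n : ℝ) ^ δ + ((2 * n + 1) * 5) * (2 * (K * (n : ℝ) ^ δ)) := by
        refine add_le_add (h₁'.trans (le_mul_of_one_le_right (by positivity) h1)) h₂
    _ = (10 * K + 2) * ((2 * n + 1) * (n : ℝ) ^ δ) := by ring
    _ ≤ (10 * K + 2) * ((3 * n) * (n : ℝ) ^ δ) := by gcongr; linarith
    _ = _ := by ring

theorem boxedMatrix_inv {n : ℕ} {A : SpecialLinearGroup (Fin 2) ℤ} (hA : BoxedMatrix n A) :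
    BoxedMatrix n A⁻¹ := by
  obtain ⟨h, h0⟩ := hA
  rw [BoxedMatrix, SpecialLinearGroup.SL2_inv_expl]
  refine ⟨fun i j => ?_, by simpa using h0⟩
  fin_cases i <;> fin_cases j <;> simp [h]

theorem inv_zero_zero (A : SpecialLinearGroup (Fin 2) ℤ) : A⁻¹.1 0 0 = A.1 1 1 := by
  simp [SpecialLinearGroup.SL2_inv_expl]

theorem inv_one_zero (A : SpecialLinearGroup (Fin 2) ℤ) : A⁻¹.1 1 0 = -A.1 1 0 := by
  simp [SpecialLinearGroup.SL2_inv_expl]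

theorem isoDisksMeet_of_not_disjoint {A B : SpecialLinearGroup (Fin 2) ℤ}
    (hA : A.1 1 0 ≠ 0) (hB : B.1 1 0 ≠ 0)
    (h : ¬ Disjoint (closure (pingDisk A)) (closure (pingDisk B))) : IsoDisksMeet A B := by
  contrapose! h
  refine Disjoint.mono Metric.closure_ball_subset_closedBall
    Metric.closure_ball_subset_closedBall (Metric.closedBall_disjoint_closedBall ?_)
  rw [IsoDisksMeet, not_le] at h
  have hA' : ((A.1 1 0 : ℤ) : ℝ) ≠ 0 := by exact_mod_cast hA
  have hB' : ((B.1 1 0 : ℤ) : ℝ) ≠ 0 := by exact_mod_cast hB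
  have hR : |(A.1 1 0 : ℝ)| + |(B.1 1 0 : ℝ)| <
      |(A.1 0 0 : ℝ) * B.1 1 0 - B.1 0 0 * A.1 1 0| := by exact_mod_cast h
  have hsub : ((A.1 0 0 : ℤ) : ℂ) / ((A.1 1 0 : ℤ) : ℂ) - ((B.1 0 0 : ℤ) : ℂ) / ((B.1 1 0 : ℤ) : ℂ)
      = (((A.1 0 0 : ℝ) * B.1 1 0 - B.1 0 0 * A.1 1 0) / (A.1 1 0 * B.1 1 0) : ℝ) := by
    rw [← Complex.ofReal_intCast, ← Complex.ofReal_intCast, ← Complex.ofReal_intCast,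
      ← Complex.ofReal_intCast, ← Complex.ofReal_div, ← Complex.ofReal_div, ← Complex.ofReal_sub]
    congr 1
    field_simp
  rw [dist_eq_norm, hsub, Complex.norm_real, Real.norm_eq_abs, abs_div, abs_mul,
    div_add_div _ _ (abs_ne_zero.mpr hA') (abs_ne_zero.mpr hB')]
  refine div_lt_div_of_pos_right ?_ (mul_pos (abs_pos.mpr hA') (abs_pos.mpr hB'))
  linarith

theorem abs_trace_le_two {A : SpecialLinearGroup (Fin 2) ℤ} (hA : A.1 1 0 ≠ 0)
    (h : ¬ Disjoint (closure (pingDisk A)) (closure (pingDisk A⁻¹))) :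
    |A.1 0 0 + A.1 1 1| ≤ 2 := by
  have h' := isoDisksMeet_of_not_disjoint hA (by rwa [inv_one_zero, neg_ne_zero]) h
  rw [IsoDisksMeet, inv_zero_zero, inv_one_zero, abs_neg,
    show A.1 0 0 * -A.1 1 0 - A.1 1 1 * A.1 1 0 = -((A.1 0 0 + A.1 1 1) * A.1 1 0) by ring,
    abs_neg, abs_mul, ← two_mul] at h'
  exact le_of_mul_le_mul_right h' (abs_pos.mpr hA)

theorem isoDisksMeet_comm {A B : SpecialLinearGroup (Fin 2) ℤ} :
    IsoDisksMeet A B ↔ IsoDisksMeet B A := by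
  rw [IsoDisksMeet, IsoDisksMeet, abs_sub_comm, add_comm]

/-- Some isometric disk of `A` or `A⁻¹` meets one of `B` or `B⁻¹`. -/
def IsoDisksInteract (A B : SpecialLinearGroup (Fin 2) ℤ) : Prop :=
  IsoDisksMeet A B ∨ IsoDisksMeet A B⁻¹ ∨ IsoDisksMeet A⁻¹ B ∨ IsoDisksMeet A⁻¹ B⁻¹

theorem isoDisksInteract_comm {A B : SpecialLinearGroup (Fin 2) ℤ} :
    IsoDisksInteract A B ↔ IsoDisksInteract B A := by
  simp only [IsoDisksInteract, @isoDisksMeet_comm A, @isoDisksMeet_comm A⁻¹]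
  tauto

theorem small_trace_or_interact_of_not_isPingPongPair {A B : SpecialLinearGroup (Fin 2) ℤ}
    (hA : A.1 1 0 ≠ 0) (hB : B.1 1 0 ≠ 0) (h : ¬ IsPingPongPair A B) :
    |A.1 0 0 + A.1 1 1| ≤ 2 ∨ |B.1 0 0 + B.1 1 1| ≤ 2 ∨ IsoDisksInteract A B := by
  have hA' : A⁻¹.1 1 0 ≠ 0 := by rwa [inv_one_zero, neg_ne_zero]
  have hB' : B⁻¹.1 1 0 ≠ 0 := by rwa [inv_one_zero, neg_ne_zero]
  contrapose! h
  obtain ⟨h1, h2, h3⟩ := h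
  simp only [IsoDisksInteract, not_or] at h3
  obtain ⟨h3, h4, h5, h6⟩ := h3
  refine ⟨?_, ?_, ?_, ?_, ?_, ?_⟩
  · exact not_not.mp fun hd => h1.not_ge (abs_trace_le_two hA hd)
  · exact not_not.mp fun hd => h3 (isoDisksMeet_of_not_disjoint hA hB hd)
  · exact not_not.mp fun hd => h4 (isoDisksMeet_of_not_disjoint hA hB' hd)
  · exact not_not.mp fun hd => h5 (isoDisksMeet_of_not_disjoint hA' hB hd)
  · exact not_not.mp fun hd => h6 (isoDisksMeet_of_not_disjoint hA' hB' hd)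
  · exact not_not.mp fun hd => h2.not_ge (abs_trace_le_two hB hd)

open Classical in
theorem card_isoDisksInteract_le (s : Finset (SpecialLinearGroup (Fin 2) ℤ)) (n : ℕ)
    (B : SpecialLinearGroup (Fin 2) ℤ) (hB : B.1 1 0 ≠ 0)
    (hs : ∀ A ∈ s, BoxedMatrix n A ∧ |A.1 1 0| ≤ |B.1 1 0| ∧ IsoDisksInteract A B) :
    (s.card : ℝ) ≤ 160 * n * harmonic n := by
  have hB' : B⁻¹.1 1 0 ≠ 0 := by rwa [inv_one_zero, neg_ne_zero]
  have direct : ∀ B' : SpecialLinearGroup (Fin 2) ℤ, B'.1 1 0 ≠ 0 → |B'.1 1 0| = |B.1 1 0| →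
      ((s.filter (fun A => IsoDisksMeet A B')).card : ℝ) ≤ 40 * n * harmonic n := by
    intro B' h0 habs
    refine card_isoDisksMeet_le _ n B' h0 fun A hA => ?_
    obtain ⟨hA, hm⟩ := mem_filter.mp hA
    exact ⟨(hs A hA).1, habs ▸ (hs A hA).2.1, hm⟩
  have inverse : ∀ B' : SpecialLinearGroup (Fin 2) ℤ, B'.1 1 0 ≠ 0 → |B'.1 1 0| = |B.1 1 0| →
      ((s.filter (fun A => IsoDisksMeet A⁻¹ B')).card : ℝ) ≤ 40 * n * harmonic n := by
    intro B' h0 habs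
    rw [← card_image_of_injective _ (inv_injective (G := SpecialLinearGroup (Fin 2) ℤ))]
    refine card_isoDisksMeet_le _ n B' h0 fun A' hA' => ?_
    obtain ⟨A, hA, rfl⟩ := mem_image.mp hA'
    obtain ⟨hA, hm⟩ := mem_filter.mp hA
    refine ⟨boxedMatrix_inv (hs A hA).1, ?_, hm⟩
    rw [inv_one_zero, abs_neg, habs]
    exact (hs A hA).2.1
  have habs : |B⁻¹.1 1 0| = |B.1 1 0| := by rw [inv_one_zero, abs_neg]
  have hcover : s = s.filter (fun A => IsoDisksMeet A B) ∪
      (s.filter (fun A => IsoDisksMeet A B⁻¹) ∪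
      (s.filter (fun A => IsoDisksMeet A⁻¹ B) ∪ s.filter (fun A => IsoDisksMeet A⁻¹ B⁻¹))) := by
    rw [← filter_or, ← filter_or, ← filter_or]
    ext A
    rw [mem_filter]
    exact ⟨fun hA => ⟨hA, (hs A hA).2.2⟩, And.left⟩
  have hcard : (s.card : ℝ) ≤ (s.filter (fun A => IsoDisksMeet A B)).card +
      ((s.filter (fun A => IsoDisksMeet A B⁻¹)).card +
      ((s.filter (fun A => IsoDisksMeet A⁻¹ B)).card +
        (s.filter (fun A => IsoDisksMeet A⁻¹ B⁻¹)).card)) := by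
    conv_lhs => rw [hcover]
    exact_mod_cast (card_union_le _ _).trans (Nat.add_le_add_left ((card_union_le _ _).trans
      (Nat.add_le_add_left (card_union_le _ _) _)) _)
  linarith [direct B hB rfl, direct B⁻¹ hB' habs, inverse B hB rfl, inverse B⁻¹ hB' habs]

theorem finite_boxedMatrix (n : ℕ) : {A | BoxedMatrix n A}.Finite := by
  have h : {M : Fin 2 → Fin 2 → ℤ | ∀ i j, M i j ∈ Set.Icc (-n : ℤ) n}.Finite :=
    Set.Finite.pi' fun _ => Set.Finite.pi' fun _ => Set.finite_Icc _ _
  refine Set.Finite.subset (h.preimage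
    (f := fun A : SpecialLinearGroup (Fin 2) ℤ => A.1) Subtype.val_injective.injOn) ?_
  exact fun A hA i j => abs_le.mp (hA.1 i j)

open Classical in
theorem card_not_isPingPongPair_le (S : Finset (SpecialLinearGroup (Fin 2) ℤ)) (n : ℕ) (T : ℝ)
    (hS : ∀ A ∈ S, BoxedMatrix n A)
    (hT : ((S.filter (fun A => |A.1 0 0 + A.1 1 1| ≤ 2)).card : ℝ) ≤ T) :
    (((S ×ˢ S).filter (fun p => ¬ IsPingPongPair p.1 p.2)).card : ℝ) ≤
      S.card * (2 * T + 320 * n * harmonic n) := by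
  set t := S.filter (fun A => |A.1 0 0 + A.1 1 1| ≤ 2)
  set E : SpecialLinearGroup (Fin 2) ℤ → Finset (SpecialLinearGroup (Fin 2) ℤ) :=
    fun B => S.filter (fun A => |A.1 1 0| ≤ |B.1 1 0| ∧ IsoDisksInteract A B)
  have hE : ((S.sigma E).card : ℝ) ≤ S.card * (160 * n * harmonic n) := by
    rw [card_sigma, ← nsmul_eq_mul]
    push_cast
    refine sum_le_card_nsmul _ _ _ fun B hB => ?_
    refine card_isoDisksInteract_le _ n B (hS B hB).2 fun A hA => ?_
    obtain ⟨hA, h⟩ := mem_filter.mp hA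
    exact ⟨hS A hA, h⟩
  have hsub : (S ×ˢ S).filter (fun p => ¬ IsPingPongPair p.1 p.2) ⊆
      t ×ˢ S ∪ (S ×ˢ t ∪ ((S.sigma E).image (fun x => (x.2, x.1)) ∪
        (S.sigma E).image (fun x => (x.1, x.2)))) := by
    rintro ⟨A, B⟩ hp
    obtain ⟨hAB, hp⟩ := mem_filter.mp hp
    obtain ⟨hA, hB⟩ := mem_product.mp hAB
    simp only [mem_union, mem_product, mem_image, mem_sigma, t, E, mem_filter]
    rcases small_trace_or_interact_of_not_isPingPongPair (hS A hA).2 (hS B hB).2 hp with h | h | h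
    · exact Or.inl ⟨⟨hA, h⟩, hB⟩
    · exact Or.inr (Or.inl ⟨hA, hB, h⟩)
    · rcases le_total |A.1 1 0| |B.1 1 0| with hle | hle
      · exact Or.inr (Or.inr (Or.inl ⟨⟨B, A⟩, ⟨hB, hA, hle, h⟩, rfl⟩))
      · exact Or.inr (Or.inr (Or.inr ⟨⟨A, B⟩, ⟨hA, hB, hle, isoDisksInteract_comm.mp h⟩, rfl⟩))
  have hcard : (((S ×ˢ S).filter (fun p => ¬ IsPingPongPair p.1 p.2)).card : ℝ) ≤
      t.card * S.card + (S.card * t.card + ((S.sigma E).card + (S.sigma E).card)) := by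
    have h := (card_le_card hsub).trans <| (card_union_le _ _).trans <|
      Nat.add_le_add_left ((card_union_le _ _).trans <| Nat.add_le_add_left
        ((card_union_le _ _).trans (add_le_add card_image_le card_image_le)) _) _
    rw [card_product, card_product] at h
    exact_mod_cast h
  have : (t.card : ℝ) * S.card ≤ T * S.card := by gcongr
  linarith

/-- for every `ε > 0` there is `C(ε)` such that for `X ≥ 2` and integers
`1 ≤ Q ≤ X`, the number of pairs of matrices in `Γ₀(Q)` of height at most `X` with
nonzero lower-left entries which do not form a ping pong pair is at most
`C(ε) · X^{3+ε} / Q`. -/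
theorem stmt7 (ε : ℝ) (hε : 0 < ε) :
    ∃ C : ℝ, 0 < C ∧ ∀ (X : ℝ) (Q : ℤ), 2 ≤ X → 1 ≤ Q → (Q : ℝ) ≤ X →
      ({p : Matrix.SpecialLinearGroup (Fin 2) ℤ × Matrix.SpecialLinearGroup (Fin 2) ℤ |
          (∀ i j, (|p.1.1 i j| : ℝ) ≤ X) ∧ (∀ i j, (|p.2.1 i j| : ℝ) ≤ X) ∧
          Q ∣ p.1.1 1 0 ∧ Q ∣ p.2.1 1 0 ∧
          p.1.1 1 0 ≠ 0 ∧ p.2.1 1 0 ≠ 0 ∧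
          ¬ IsPingPongPair p.1 p.2}.ncard : ℝ)
        ≤ C * X ^ (3 + ε) / (Q : ℝ) := by
  classical
  set δ := ε / 2 with hδ_def
  have hδ : 0 < δ := by positivity
  obtain ⟨K, hK, htrace⟩ := exists_card_small_trace_le δ hδ
  set L : ℝ := 1 + 1 / δ
  have hL : 0 < L := by positivity
  refine ⟨24 * L * (2 * K + 320 * L), by positivity, fun X Q hX hQ _ => ?_⟩
  have hQ0 : (0 : ℝ) < Q := by exact_mod_cast hQ
  set n := ⌊X⌋₊
  have hn : 2 ≤ n := Nat.le_floor (by exact_mod_cast hX)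
  have hnR : (2 : ℝ) ≤ n := by exact_mod_cast hn
  have hnX : (n : ℝ) ≤ X := Nat.floor_le (by linarith)
  have hentry : ∀ z : ℤ, (|z| : ℝ) ≤ X → |z| ≤ n := by
    intro z hz
    rw [Int.abs_eq_natAbs]
    refine Int.ofNat_le.mpr (Nat.le_floor ?_)
    rwa [Nat.cast_natAbs, Int.cast_abs]
  set S := (finite_boxedMatrix n).toFinset.filter (fun A => Q ∣ A.1 1 0)
  have hS : ∀ A ∈ S, BoxedMatrix n A ∧ Q ∣ A.1 1 0 := fun A hA => by simpa [S] using hA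
  set P : ℝ := (n : ℝ) ^ δ
  have hP : 0 < P := Real.rpow_pos_of_pos (by linarith) _
  have hH : (harmonic n : ℝ) ≤ L * P := harmonic_le_const_mul_rpow δ hδ n (by omega)
  have hH0 : (0 : ℝ) ≤ harmonic n := by exact_mod_cast (harmonic_pos (by omega)).le
  have hScard : (S.card : ℝ) ≤ 24 * L * (n ^ 2 * P) / Q := by
    calc (S.card : ℝ) ≤ (2 * n + 1) * (8 * n * harmonic n / Q) := card_boxed_le S n Q hQ hS
      _ ≤ (3 * n) * (8 * n * (L * P) / Q) :=
          mul_le_mul (by linarith) (by gcongr) (div_nonneg (mul_nonneg (by positivity) hH0) hQ0.le)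
            (by positivity)
      _ = _ := by ring
  have hpairs := card_not_isPingPongPair_le S n (K * (n * P)) (fun A hA => (hS A hA).1)
    (htrace n _ hn fun A hA => by
      obtain ⟨hA, h⟩ := mem_filter.mp hA
      exact ⟨(hS A hA).1, h⟩)
  have hpow : (n : ℝ) ^ 3 * (P * P) ≤ X ^ (3 + ε) := by
    calc (n : ℝ) ^ 3 * (P * P) = (n : ℝ) ^ (3 + ε) := by
          rw [← Real.rpow_add (by linarith), ← Real.rpow_natCast, ← Real.rpow_add (by linarith)]
          congr 1
          rw [hδ_def]; push_cast; ring
      _ ≤ X ^ (3 + ε) := Real.rpow_le_rpow (by positivity) hnX (by positivity)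
  refine le_trans ?_ (hpairs.trans ?_)
  · rw [← Set.ncard_coe_finset]
    refine Nat.cast_le.mpr (Set.ncard_le_ncard ?_ (Finset.finite_toSet _))
    rintro ⟨A, B⟩ ⟨hA, hB, hQA, hQB, hA0, hB0, hp⟩
    simp only [coe_filter, mem_product, Set.mem_ofPred_eq, S, mem_filter, Set.Finite.mem_toFinset]
    exact ⟨⟨⟨⟨fun i j => hentry _ (hA i j), hA0⟩, hQA⟩,
      ⟨⟨fun i j => hentry _ (hB i j), hB0⟩, hQB⟩⟩, hp⟩
  · calc _ ≤ (24 * L * (n ^ 2 * P) / Q) * (2 * (K * (n * P)) + 320 * n * (L * P)) := by gcongr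
      _ = 24 * L * (2 * K + 320 * L) * ((n : ℝ) ^ 3 * (P * P)) / Q := by ring
      _ ≤ _ := by gcongr
end

section
/- For every ε > 0 and integer s ≥ 1 there is a constant C(ε, s) such that for all reals X ≥ 2 and integers Q with 1 ≤ Q ≤ X, the number of s-tuples (A₁, ..., A_s) ∈ Γ₀(Q)^s of matrices of height at most X that do NOT freely generate a free subgroup of SL₂(ℤ) is at most C(ε, s) · X^{2s-1+ε} · Q^{-s+1}. -/
/-- A tuple `(A₁, …, A_s)` is non-free: some nonempty reduced word in the `A_i^{±1}`
equals the identity. -/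
def IsNonFreeTuple {s : ℕ} (A : Fin s → Matrix.SpecialLinearGroup (Fin 2) ℤ) : Prop :=
  ∃ (m : ℕ), 1 ≤ m ∧ ∃ (ν : ℕ → Fin s) (e : ℕ → ℤ),
    (∀ i < m, e i = 1 ∨ e i = -1) ∧
    (∀ i, i + 1 < m → ¬(ν (i + 1) = ν i ∧ e (i + 1) = -e i)) ∧
    ((List.range m).map (fun i => A (ν i) ^ e i)).prod = 1

open Finset

/-- The divisor function is bounded by `C * n ^ ε`. -/
theorem exists_card_divisors_le_rpow_s8 {ε : ℝ} (hε : 0 < ε) :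
    ∃ C : ℝ, 1 ≤ C ∧ ∀ n : ℕ, n ≠ 0 → (#n.divisors : ℝ) ≤ C * (n : ℝ) ^ ε := by
  set c : ℝ := max 1 (1 / (ε * Real.log 2))
  have hc1 : 1 ≤ c := le_max_left _ _
  have hlog : 0 < ε * Real.log 2 := mul_pos hε (Real.log_pos one_lt_two)
  have hc : 1 ≤ c * (ε * Real.log 2) := by
    rw [← div_le_iff₀ hlog]
    exact le_max_right _ _
  obtain ⟨P, hP⟩ := exists_nat_ge ((2 : ℝ) ^ (1 / ε))
  have hlarge : ∀ p k : ℕ, P ≤ p → (k + 1 : ℝ) ≤ ((p : ℝ) ^ k) ^ ε := by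
    intro p k hp
    have h2 : (2 : ℝ) ≤ (p : ℝ) ^ ε := by
      calc (2 : ℝ) = ((2 : ℝ) ^ (1 / ε)) ^ ε := by
            rw [← Real.rpow_mul zero_le_two, one_div_mul_cancel hε.ne', Real.rpow_one]
        _ ≤ (p : ℝ) ^ ε := by
            gcongr
            exact hP.trans (by exact_mod_cast hp)
    calc (k + 1 : ℝ) ≤ 2 ^ k := by exact_mod_cast Nat.lt_two_pow_self
      _ ≤ ((p : ℝ) ^ ε) ^ k := by gcongr
      _ = ((p : ℝ) ^ k) ^ ε := Real.rpow_pow_comm (Nat.cast_nonneg _) _ _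
  have hsmall : ∀ p k : ℕ, 2 ≤ p → (k + 1 : ℝ) ≤ c * ((p : ℝ) ^ k) ^ ε := by
    intro p k hp
    have h2 : 1 + k * (ε * Real.log 2) ≤ ((p : ℝ) ^ k) ^ ε := by
      calc 1 + k * (ε * Real.log 2) ≤ Real.exp (k * (ε * Real.log 2)) := by
            linarith [Real.add_one_le_exp (k * (ε * Real.log 2))]
        _ = ((2 : ℝ) ^ k) ^ ε := by
            rw [Real.rpow_def_of_pos (by positivity), Real.log_pow]
            ring_nf
        _ ≤ ((p : ℝ) ^ k) ^ ε := by
            gcongr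
            exact_mod_cast hp
    calc (k + 1 : ℝ) ≤ c * (1 + k * (ε * Real.log 2)) := by
          nlinarith [mul_le_mul_of_nonneg_left hc (Nat.cast_nonneg (α := ℝ) k)]
      _ ≤ _ := by gcongr
  refine ⟨c ^ P, one_le_pow₀ hc1, fun n hn ↦ ?_⟩
  have hprod : ∏ p ∈ n.primeFactors, ((p : ℝ) ^ n.factorization p) ^ ε = (n : ℝ) ^ ε := by
    rw [Real.finsetProd_rpow _ _ (fun _ _ ↦ by positivity)]
    congr 1
    exact_mod_cast Nat.prod_factorization_pow_eq_self hn
  calc (#n.divisors : ℝ) = ∏ p ∈ n.primeFactors, (n.factorization p + 1 : ℝ) := by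
        rw [Nat.card_divisors hn]
        push_cast
        rfl
    _ ≤ ∏ p ∈ n.primeFactors, (if p < P then c else 1) * ((p : ℝ) ^ n.factorization p) ^ ε := by
        refine prod_le_prod (fun _ _ ↦ by positivity) fun p hp ↦ ?_
        split_ifs with h
        · exact hsmall p _ (Nat.prime_of_mem_primeFactors hp).two_le
        · rw [one_mul]
          exact hlarge p _ (not_lt.1 h)
    _ = c ^ #(n.primeFactors.filter (· < P)) * (n : ℝ) ^ ε := by
        rw [prod_mul_distrib, hprod, prod_ite, prod_const, prod_const_one, mul_one]
    _ ≤ c ^ P * (n : ℝ) ^ ε := by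
        refine mul_le_mul_of_nonneg_right (pow_le_pow_right₀ hc1 ?_) (by positivity)
        calc _ ≤ #(range P) := card_le_card fun p hp ↦ by simpa using (mem_filter.1 hp).2
          _ = P := card_range P

theorem det_entries (A : Matrix.SpecialLinearGroup (Fin 2) ℤ) :
    A.1 0 0 * A.1 1 1 - A.1 0 1 * A.1 1 0 = 1 := by
  rw [← Matrix.det_fin_two, A.2]

/-- The intervals `|d / c - x| ≤ 1 / |c|` attached to the bottom rows of `A` and `B` meet. -/
def Collide (A B : Matrix.SpecialLinearGroup (Fin 2) ℤ) : Prop :=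
  |A.1 1 0 * B.1 1 1 - B.1 1 0 * A.1 1 1| ≤ |A.1 1 0| + |B.1 1 0|

instance : DecidableRel Collide := fun _ _ ↦ inferInstanceAs (Decidable (_ ≤ _))

/-- Ping-pong: a nonempty product in which no factor collides with the inverse of its successor
is nontrivial. -/
theorem prod_ne_one_of_not_collide {m : ℕ} (hm : 1 ≤ m)
    (g : ℕ → Matrix.SpecialLinearGroup (Fin 2) ℤ) (hg : ∀ i < m, (g i).1 1 0 ≠ 0)
    (hc : ∀ i, i + 1 < m → ¬ Collide (g i) (g (i + 1))⁻¹) :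
    ((List.range m).map g).prod ≠ 1 := by
  have key : ∀ k, k + 1 ≤ m → ∃ W : Matrix.SpecialLinearGroup (Fin 2) ℤ,
      ((List.range (k + 1)).map g).prod = W ∧ W.1 1 0 ≠ 0 ∧
        |(g k).1 1 1 * W.1 1 0 - (g k).1 1 0 * W.1 1 1| ≤ |W.1 1 0| := by
    intro k
    induction k with
    | zero =>
      intro h
      exact ⟨g 0, by simp, hg 0 h, by rw [mul_comm, sub_self, abs_zero]; positivity⟩
    | succ k ih =>
      intro h
      obtain ⟨W, hW, hx, hR⟩ := ih (by omega)
      have hcol := hc k h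
      have hdet := det_entries (g (k + 1))
      refine ⟨W * g (k + 1), by rw [List.range_succ, List.map_append, List.prod_append, hW]; simp,
        ?_⟩
      simp only [Collide, Matrix.SpecialLinearGroup.coe_inv, Matrix.adjugate_fin_two,
        Matrix.of_apply, Matrix.cons_val', Matrix.cons_val_zero, Matrix.cons_val_one,
        Matrix.SpecialLinearGroup.coe_mul, Matrix.mul_apply, Fin.sum_univ_two, not_le,
        Matrix.cons_val_fin_one, abs_neg] at hcol ⊢
      generalize (g k).1 1 0 = c₀ at *
      generalize (g k).1 1 1 = d₀ at *
      generalize (g (k + 1)).1 0 0 = a at *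
      generalize (g (k + 1)).1 0 1 = b at *
      generalize (g (k + 1)).1 1 0 = c at *
      generalize (g (k + 1)).1 1 1 = d at *
      generalize W.1 1 0 = x at *
      generalize W.1 1 1 = y at *
      have hgrow : |x| < |x * a + y * c| := by
        by_contra! hle
        have h1 : |x| * |c₀ * a - -c * d₀| ≤ |c₀| * |x| + |c| * |x| := by
          calc |x| * |c₀ * a - -c * d₀|
              = |c₀ * (x * a + y * c) + c * (d₀ * x - c₀ * y)| := by
                rw [← abs_mul]; ring_nf
            _ ≤ |c₀| * |x * a + y * c| + |c| * |d₀ * x - c₀ * y| := by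
                rw [← abs_mul, ← abs_mul]; exact abs_add_le _ _
            _ ≤ _ := by gcongr
        nlinarith [abs_pos.2 hx]
      refine ⟨abs_pos.1 ((abs_nonneg x).trans_lt hgrow), ?_⟩
      have : d * (x * a + y * c) - c * (x * b + y * d) = x := by linear_combination x * hdet
      rw [this]
      exact hgrow.le
  obtain ⟨k, rfl⟩ : ∃ k, m = k + 1 := ⟨m - 1, by omega⟩
  obtain ⟨W, hW, hx, -⟩ := key k le_rfl
  rw [hW]
  rintro rfl
  simp at hx

theorem abs_trace_le_two_of_lower_left_eq_zero {A : Matrix.SpecialLinearGroup (Fin 2) ℤ}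
    (h : A.1 1 0 = 0) : |A.1 0 0 + A.1 1 1| ≤ 2 := by
  have hdet := det_entries A
  rw [h, mul_zero, sub_zero] at hdet
  rcases Int.mul_eq_one_iff_eq_one_or_neg_one.1 hdet with ⟨h1, h2⟩ | ⟨h1, h2⟩ <;> simp [h1, h2]

theorem zpow_lower_left_ne_zero {A : Matrix.SpecialLinearGroup (Fin 2) ℤ} (h : A.1 1 0 ≠ 0)
    {e : ℤ} (he : e = 1 ∨ e = -1) : (A ^ e).1 1 0 ≠ 0 := by
  rcases he with rfl | rfl
  · simpa using h
  · simpa [Matrix.SpecialLinearGroup.coe_inv, Matrix.adjugate_fin_two] using h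

theorem not_collide_zpow_neg {A : Matrix.SpecialLinearGroup (Fin 2) ℤ}
    (h : 2 < |A.1 0 0 + A.1 1 1|) (h0 : A.1 1 0 ≠ 0) {e : ℤ} (he : e = 1 ∨ e = -1) :
    ¬ Collide (A ^ e) (A ^ e)⁻¹ := by
  have h1 : 2 * |A.1 1 0| < |A.1 1 0 * (A.1 0 0 + A.1 1 1)| := by
    rw [abs_mul]
    nlinarith [abs_pos.2 h0]
  rw [Collide, not_le]
  rcases he with rfl | rfl
  · simp only [zpow_one, Matrix.SpecialLinearGroup.coe_inv, Matrix.adjugate_fin_two,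
      Matrix.of_apply, Matrix.cons_val', Matrix.cons_val_zero, Matrix.cons_val_one,
      Matrix.cons_val_fin_one, abs_neg]
    rw [← two_mul]
    refine h1.trans_eq (congrArg abs ?_)
    ring
  · simp only [zpow_neg_one, inv_inv, Matrix.SpecialLinearGroup.coe_inv, Matrix.adjugate_fin_two,
      Matrix.of_apply, Matrix.cons_val', Matrix.cons_val_zero, Matrix.cons_val_one,
      Matrix.cons_val_fin_one, abs_neg]
    rw [← two_mul, ← abs_neg (-A.1 1 0 * _ - _)]
    refine h1.trans_eq (congrArg abs ?_)
    ring

/-- A non-free tuple has an entry of small trace or a colliding pair of distinct entries. -/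
theorem IsNonFreeTuple.exists_trace_or_collide {s : ℕ}
    {A : Fin s → Matrix.SpecialLinearGroup (Fin 2) ℤ} (hA : IsNonFreeTuple A) :
    (∃ k, |(A k).1 0 0 + (A k).1 1 1| ≤ 2) ∨
      ∃ i j, i ≠ j ∧ ∃ e ∈ ({1, -1} : Finset ℤ), ∃ f ∈ ({1, -1} : Finset ℤ),
        (A i ^ e).1 1 0 ≠ 0 ∧ (A j ^ f).1 1 0 ≠ 0 ∧ Collide (A i ^ e) (A j ^ f) := by
  by_contra! hcon
  obtain ⟨htr, hcol⟩ := hcon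
  obtain ⟨m, hm, ν, e, he, hred, hprod⟩ := hA
  have h0 : ∀ k, (A k).1 1 0 ≠ 0 := fun k hk ↦
    (abs_trace_le_two_of_lower_left_eq_zero hk).not_gt (htr k)
  refine prod_ne_one_of_not_collide hm _ (fun i hi ↦ zpow_lower_left_ne_zero (h0 _) (he i hi))
    (fun i hi ↦ ?_) hprod
  have he₀ := he i (by omega)
  have he₁ := he (i + 1) hi
  by_cases hν : ν (i + 1) = ν i
  · have hee : e (i + 1) = e i := by
      have := hred i hi
      rw [not_and] at this
      have := this hν
      omega
    rw [hν, hee]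
    exact not_collide_zpow_neg (htr _) (h0 _) he₀
  · rw [← zpow_neg]
    refine hcol _ _ (Ne.symm hν) (e i) (by simpa using he₀) (-e (i + 1)) (by simp; omega)
      (zpow_lower_left_ne_zero (h0 _) he₀) (zpow_lower_left_ne_zero (h0 _) (by omega))

/-- There are finitely many matrices of height at most `N` in `Γ₀(Q)`. -/
theorem finite_height_le (N Q : ℕ) : {A : Matrix.SpecialLinearGroup (Fin 2) ℤ |
    (∀ i j, |A.1 i j| ≤ N) ∧ (Q : ℤ) ∣ A.1 1 0}.Finite := by
  refine Set.Finite.of_finite_image (f := fun A ↦ (A.1 : Fin 2 → Fin 2 → ℤ)) ?_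
    Subtype.val_injective.injOn
  refine (Set.Finite.pi' fun _ ↦ Set.Finite.pi' fun _ ↦ Set.finite_Icc (-(N : ℤ)) N).subset ?_
  rintro _ ⟨A, hA, rfl⟩ i j
  exact abs_le.1 (hA.1 i j)

/-- The matrices of height at most `N` in `Γ₀(Q)`, as a finset. -/
noncomputable def gammaBox (N Q : ℕ) : Finset (Matrix.SpecialLinearGroup (Fin 2) ℤ) :=
  (finite_height_le N Q).toFinset

theorem mem_gammaBox {N Q : ℕ} {A : Matrix.SpecialLinearGroup (Fin 2) ℤ} :
    A ∈ gammaBox N Q ↔ (∀ i j, |A.1 i j| ≤ N) ∧ (Q : ℤ) ∣ A.1 1 0 := by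
  simp [gammaBox]

theorem zpow_mem_gammaBox {N Q : ℕ} {A : Matrix.SpecialLinearGroup (Fin 2) ℤ}
    (hA : A ∈ gammaBox N Q) {e : ℤ} (he : e ∈ ({1, -1} : Finset ℤ)) : A ^ e ∈ gammaBox N Q := by
  simp only [mem_insert, mem_singleton] at he
  rcases he with rfl | rfl
  · simpa using hA
  · rw [mem_gammaBox] at hA ⊢
    simp only [zpow_neg_one, Matrix.SpecialLinearGroup.coe_inv, Matrix.adjugate_fin_two]
    simp only [Fin.forall_fin_two] at hA
    simp [Fin.forall_fin_two, hA]

theorem sl2_ext {A B : Matrix.SpecialLinearGroup (Fin 2) ℤ} (h00 : A.1 0 0 = B.1 0 0)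
    (h01 : A.1 0 1 = B.1 0 1) (h10 : A.1 1 0 = B.1 1 0) (h11 : A.1 1 1 = B.1 1 1) : A = B := by
  apply Subtype.ext
  ext i j
  fin_cases i <;> fin_cases j <;> assumption

/-- Factorisations `x * y = n` with `|x|, |y| ≤ N`. -/
noncomputable def factorPairs (N : ℕ) (n : ℤ) : Finset (ℤ × ℤ) :=
  (Icc (-(N : ℤ)) N ×ˢ Icc (-(N : ℤ)) N).filter fun p ↦ p.1 * p.2 = n

theorem mem_factorPairs {N : ℕ} {n : ℤ} {p : ℤ × ℤ} :
    p ∈ factorPairs N n ↔ |p.1| ≤ N ∧ |p.2| ≤ N ∧ p.1 * p.2 = n := by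
  simp [factorPairs, abs_le, and_assoc]

theorem card_factorPairs_le {N : ℕ} {n : ℤ} (hn : n ≠ 0) :
    #(factorPairs N n) ≤ 2 * #n.natAbs.divisors := by
  have hmem : ∀ p ∈ factorPairs N n,
      p.1 ∈ n.natAbs.divisors.image (fun k : ℕ ↦ (k : ℤ)) ∪
        n.natAbs.divisors.image (fun k : ℕ ↦ -(k : ℤ)) := by
    intro p hp
    have hdiv : p.1.natAbs ∈ n.natAbs.divisors := by
      rw [Nat.mem_divisors]
      refine ⟨Int.natAbs_dvd_natAbs.2 ⟨p.2, (mem_factorPairs.1 hp).2.2.symm⟩, by simpa using hn⟩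
    rw [mem_union, mem_image, mem_image]
    rcases Int.natAbs_eq p.1 with h | h
    · exact Or.inl ⟨_, hdiv, h.symm⟩
    · exact Or.inr ⟨_, hdiv, h.symm⟩
  have hinj : Set.InjOn Prod.fst (factorPairs N n : Set (ℤ × ℤ)) := by
    intro p hp q hq h
    have h1 := (mem_factorPairs.1 hp).2.2
    have h2 := (mem_factorPairs.1 hq).2.2
    refine Prod.ext h (mul_left_cancel₀ (a := p.1) ?_ ?_)
    · rintro h0
      exact hn (by rw [← h1, h0, zero_mul])
    · rw [h1, h, h2]
  calc #(factorPairs N n) ≤ _ := card_le_card_of_injOn Prod.fst hmem hinj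
    _ ≤ _ := card_union_le _ _
    _ ≤ #n.natAbs.divisors + #n.natAbs.divisors := add_le_add card_image_le card_image_le
    _ = _ := (two_mul _).symm

theorem card_Icc_neg_le {N : ℕ} (hN : 1 ≤ N) : #(Icc (-(N : ℤ)) N) ≤ 3 * N := by
  rw [Int.card_Icc]
  omega

theorem card_factorPairs_zero_le {N : ℕ} (hN : 1 ≤ N) : #(factorPairs N 0) ≤ 6 * N := by
  have hsub : factorPairs N 0 ⊆ ({0} ×ˢ Icc (-(N : ℤ)) N) ∪ (Icc (-(N : ℤ)) N ×ˢ {0}) := by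
    intro p hp
    obtain ⟨h1, h2, h3⟩ := mem_factorPairs.1 hp
    rw [abs_le] at h1 h2
    simp only [mem_union, mem_product, mem_singleton, mem_Icc]
    rcases mul_eq_zero.1 h3 with h | h
    · exact Or.inl ⟨h, h2⟩
    · exact Or.inr ⟨h1, h⟩
  have h3 := card_Icc_neg_le hN
  calc _ ≤ _ := card_le_card hsub
    _ ≤ _ := card_union_le _ _
    _ ≤ _ := by
      rw [card_product, card_product, card_singleton, one_mul, mul_one]
      omega

/-- A set of integers of diameter at most `L` has at most `L + 1` elements. -/
theorem card_le_of_sub_le {S : Finset ℤ} {L : ℕ} (h : ∀ x ∈ S, ∀ y ∈ S, x - y ≤ L) :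
    #S ≤ L + 1 := by
  rcases S.eq_empty_or_nonempty with rfl | hS
  · simp
  have hsub : S ⊆ Icc (S.min' hS) (S.min' hS + L) := fun x hx ↦
    mem_Icc.2 ⟨S.min'_le x hx, by linarith [h x hx _ (S.min'_mem hS)]⟩
  refine (card_le_card hsub).trans ?_
  rw [Int.card_Icc]
  omega

/-- A set of integers in `[-N, N]` lying in one residue class modulo `c ≤ N` has at most
`3 * N / c` elements. -/
theorem card_mul_le_of_dvd_sub {S : Finset ℤ} {N c : ℕ} (hc : 1 ≤ c) (hcN : c ≤ N)
    (hS : ∀ x ∈ S, |x| ≤ N) (h : ∀ x ∈ S, ∀ y ∈ S, (c : ℤ) ∣ x - y) : #S * c ≤ 3 * N := by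
  have hc' : (0 : ℤ) < c := by exact_mod_cast hc
  have hinj : Set.InjOn (fun x : ℤ ↦ (x + N) / c) (S : Set ℤ) := by
    intro x hx y hy hxy
    have h1 : y + N ≡ x + N [ZMOD c] := Int.modEq_iff_dvd.2 (by simpa using h x hx y hy)
    have h2 := Int.emod_add_mul_ediv (x + N) c
    have h3 := Int.emod_add_mul_ediv (y + N) c
    dsimp only at hxy
    rw [hxy, ← h1.eq] at h2
    linarith
  have hcard : #S ≤ #(Icc (0 : ℤ) ((2 * N) / c)) := by
    refine card_le_card_of_injOn _ (fun x hx ↦ ?_) hinj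
    have := abs_le.1 (hS x hx)
    simp only [coe_Icc, Set.mem_Icc]
    exact ⟨Int.ediv_nonneg (by linarith) hc'.le, Int.ediv_le_ediv hc' (by linarith)⟩
  rw [Int.card_Icc] at hcard
  have h4 : #S ≤ 2 * N / c + 1 := by
    refine hcard.trans ?_
    have : ((2 * N : ℤ) / c) = ((2 * N / c : ℕ) : ℤ) := by push_cast; rfl
    rw [this, sub_zero, ← Nat.cast_succ, Int.toNat_natCast]
  calc #S * c ≤ (2 * N / c + 1) * c := by gcongr
    _ = 2 * N / c * c + c := by ring
    _ ≤ 2 * N + N := add_le_add (Nat.div_mul_le_self _ _) hcN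
    _ = 3 * N := by ring

theorem dvd_sub_of_dvd_mul_sub_one {a d d' c : ℤ} (h : c ∣ a * d - 1) (h' : c ∣ a * d' - 1) :
    c ∣ d - d' := by
  have hcop : IsCoprime c a := by
    obtain ⟨k, hk⟩ := h
    exact ⟨-k, d, by linear_combination hk⟩
  refine hcop.dvd_of_dvd_mul_left ?_
  have := dvd_sub h h'
  convert this using 1
  ring

theorem card_filter_diag_le {N Q : ℕ} {S : Finset (Matrix.SpecialLinearGroup (Fin 2) ℤ)}
    (hS : S ⊆ gammaBox N Q) (p : ℤ × ℤ) :
    #{A ∈ S | (A.1 0 0, A.1 1 1) = p} ≤ #(factorPairs N (p.1 * p.2 - 1)) := by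
  refine card_le_card_of_injOn (fun A ↦ (A.1 0 1, A.1 1 0)) (fun A hA ↦ ?_) fun A hA B hB h ↦ ?_
  · obtain ⟨hAS, rfl⟩ := mem_filter.1 hA
    have hdet := det_entries A
    have := (mem_gammaBox.1 (hS hAS)).1
    exact mem_factorPairs.2 ⟨this _ _, this _ _, by dsimp only; linarith⟩
  · have hA := (mem_filter.1 hA).2
    have hB := (mem_filter.1 hB).2
    rw [← hB] at hA
    simp only [Prod.mk.injEq] at hA h
    exact sl2_ext hA.1 h.1 h.2 hA.2

/-- `D` bounds the number of factorisations of all nonzero integers of size at most `N ^ 2 + 1`. -/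
def FactorBound (N D : ℕ) : Prop :=
  1 ≤ D ∧ ∀ n : ℤ, n ≠ 0 → |n| ≤ (N : ℤ) ^ 2 + 1 → #(factorPairs N n) ≤ D

theorem abs_mul_add_le {N : ℕ} {x y z : ℤ} (hx : |x| ≤ N) (hy : |y| ≤ N) (hz : |z| ≤ 1) :
    |x * y + z| ≤ (N : ℤ) ^ 2 + 1 := by
  calc |x * y + z| ≤ |x| * |y| + |z| := by rw [← abs_mul]; exact abs_add_le _ _
    _ ≤ N * N + 1 := by gcongr
    _ = _ := by ring

theorem card_le_of_diag_mem {N Q D : ℕ} (hN : 1 ≤ N) (hD : FactorBound N D)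
    {S : Finset (Matrix.SpecialLinearGroup (Fin 2) ℤ)} (hS : S ⊆ gammaBox N Q)
    {P : Finset (ℤ × ℤ)} (hP : ∀ A ∈ S, (A.1 0 0, A.1 1 1) ∈ P) :
    #S ≤ D * #P + 12 * N := by
  rw [← card_filter_add_card_filter_not (s := S) fun A ↦ A.1 0 0 * A.1 1 1 ≠ 1]
  refine add_le_add ?_ ?_
  · refine card_le_mul_card_image_of_maps_to (f := fun A ↦ (A.1 0 0, A.1 1 1))
      (fun A hA ↦ hP A (mem_filter.1 hA).1) D fun p _ ↦ ?_
    rcases (filter (fun A : Matrix.SpecialLinearGroup (Fin 2) ℤ ↦ (A.1 0 0, A.1 1 1) = p)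
      {A ∈ S | A.1 0 0 * A.1 1 1 ≠ 1}).eq_empty_or_nonempty with h | ⟨A, hA⟩
    · rw [h, card_empty]
      exact Nat.zero_le _
    obtain ⟨hA', rfl⟩ := mem_filter.1 hA
    obtain ⟨hAS, hne⟩ := mem_filter.1 hA'
    have hA := (mem_gammaBox.1 (hS hAS)).1
    refine (card_filter_diag_le ((filter_subset _ _).trans hS) _).trans
      (hD.2 _ (sub_ne_zero.2 hne) ?_)
    exact abs_mul_add_le (z := -1) (hA _ _) (hA _ _) (by simp)
  · have : 12 * N = 6 * N * #({(1, 1), (-1, -1)} : Finset (ℤ × ℤ)) := by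
      rw [card_pair (by decide)]
      ring
    rw [this]
    refine card_le_mul_card_image_of_maps_to (f := fun A ↦ (A.1 0 0, A.1 1 1))
      (fun A hA ↦ ?_) _ fun p hp ↦ ?_
    · have := not_not.1 (mem_filter.1 hA).2
      rcases Int.mul_eq_one_iff_eq_one_or_neg_one.1 this with ⟨h1, h2⟩ | ⟨h1, h2⟩ <;>
        simp [h1, h2]
    · refine (card_filter_diag_le ((filter_subset _ _).trans hS) _).trans ?_
      have : p.1 * p.2 - 1 = 0 := by
        simp only [mem_insert, mem_singleton] at hp
        rcases hp with rfl | rfl <;> rfl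
      rw [this]
      exact card_factorPairs_zero_le hN

theorem card_small_trace_le {N Q D : ℕ} (hN : 1 ≤ N) (hD : FactorBound N D) :
    #{A ∈ gammaBox N Q | |A.1 0 0 + A.1 1 1| ≤ 2} ≤ 27 * (N * D) := by
  have h := card_le_of_diag_mem hN hD
    (filter_subset (fun A ↦ |A.1 0 0 + A.1 1 1| ≤ 2) (gammaBox N Q))
    (P := (Icc (-(N : ℤ)) N ×ˢ Icc (-2) 2).image fun p ↦ (p.1, p.2 - p.1)) fun A hA ↦ ?_
  · have h1 : #((Icc (-(N : ℤ)) N ×ˢ Icc (-2 : ℤ) 2).image fun p ↦ (p.1, p.2 - p.1)) ≤ 15 * N := by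
      refine card_image_le.trans ?_
      have := card_Icc_neg_le hN
      rw [card_product, show #(Icc (-2 : ℤ) 2) = 5 from rfl]
      omega
    calc _ ≤ _ := h
      _ ≤ D * (15 * N) + 12 * N := by gcongr
      _ ≤ _ := by nlinarith [hD.1]
  · obtain ⟨hA, ht⟩ := mem_filter.1 hA
    have hA := abs_le.1 ((mem_gammaBox.1 hA).1 0 0)
    rw [abs_le] at ht
    refine mem_image.2 ⟨(A.1 0 0, A.1 0 0 + A.1 1 1), ?_, by simp⟩
    simp only [mem_product, mem_Icc]
    exact ⟨hA, ht⟩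

theorem card_gammaBox_mul_le {N Q D : ℕ} (hN : 1 ≤ N) (hQ : 1 ≤ Q) (hQN : Q ≤ N)
    (hD : FactorBound N D) : #(gammaBox N Q) * Q ≤ 21 * (N ^ 2 * D) := by
  have h := card_le_of_diag_mem hN hD (subset_refl (gammaBox N Q))
    (P := (Icc (-(N : ℤ)) N ×ˢ Icc (-(N : ℤ)) N).filter fun p ↦ (Q : ℤ) ∣ p.1 * p.2 - 1)
    fun A hA ↦ ?_
  · have h1 : #((Icc (-(N : ℤ)) N ×ˢ Icc (-(N : ℤ)) N).filter
        fun p ↦ (Q : ℤ) ∣ p.1 * p.2 - 1) ≤ 3 * N / Q * #(Icc (-(N : ℤ)) N) := by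
      refine card_le_mul_card_image_of_maps_to (f := Prod.fst)
        (fun p hp ↦ (mem_product.1 (mem_filter.1 hp).1).1) _ fun a _ ↦ ?_
      rw [Nat.le_div_iff_mul_le hQ, ← card_image_of_injOn (f := Prod.snd)]
      · refine card_mul_le_of_dvd_sub hQ hQN ?_ ?_
        · intro x hx
          obtain ⟨p, hp, rfl⟩ := mem_image.1 hx
          rw [abs_le]
          exact mem_Icc.1 (mem_product.1 (mem_filter.1 (mem_filter.1 hp).1).1).2
        · intro x hx y hy
          obtain ⟨p, hp, rfl⟩ := mem_image.1 hx
          obtain ⟨q, hq, rfl⟩ := mem_image.1 hy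
          obtain ⟨hp', rfl⟩ := mem_filter.1 hp
          obtain ⟨hq', hpq⟩ := mem_filter.1 hq
          exact dvd_sub_of_dvd_mul_sub_one (mem_filter.1 hp').2 (hpq ▸ (mem_filter.1 hq').2)
      · intro p hp q hq hpq
        exact Prod.ext ((mem_filter.1 hp).2.trans (mem_filter.1 hq).2.symm) hpq
    have h2 := card_Icc_neg_le hN
    calc #(gammaBox N Q) * Q ≤ (D * (3 * N / Q * (3 * N)) + 12 * N) * Q := by
          gcongr
          exact h.trans (by gcongr; exact h1.trans (by gcongr))
      _ = 3 * N / Q * Q * (D * (3 * N)) + 12 * N * Q := by ring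
      _ ≤ 3 * N * (D * (3 * N)) + 12 * N * N := by
          have := Nat.div_mul_le_self (3 * N) Q
          exact add_le_add (Nat.mul_le_mul_right _ this) (Nat.mul_le_mul_left _ hQN)
      _ ≤ _ := by nlinarith [hD.1, Nat.mul_le_mul_left (N ^ 2) hD.1]
  · have hA' := (mem_gammaBox.1 hA).1
    have hdet := det_entries A
    rw [mem_filter, mem_product, mem_Icc, mem_Icc, ← abs_le, ← abs_le]
    refine ⟨⟨hA' _ _, hA' _ _⟩, ?_⟩
    dsimp only
    rw [show A.1 0 0 * A.1 1 1 - 1 = A.1 0 1 * A.1 1 0 by linarith]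
    exact dvd_mul_of_dvd_right (mem_gammaBox.1 hA).2 _

theorem card_lower_left_eq_le {N Q D : ℕ} (hN : 1 ≤ N) (hD : FactorBound N D) {c : ℤ}
    (hc : c ≠ 0) (hcN : |c| ≤ N) : #{A ∈ gammaBox N Q | A.1 1 0 = c} ≤ 9 * (N * D) := by
  have hfib : ∀ (S : Finset (Matrix.SpecialLinearGroup (Fin 2) ℤ)),
      S ⊆ gammaBox N Q → (∀ A ∈ S, A.1 1 0 = c) → ∀ b : ℤ,
      #{A ∈ S | A.1 0 1 = b} ≤ #(factorPairs N (b * c + 1)) := by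
    intro S hS hSc b
    refine card_le_card_of_injOn (fun A ↦ (A.1 0 0, A.1 1 1)) (fun A hA ↦ ?_)
      fun A hA B hB h ↦ ?_
    · obtain ⟨hAS, rfl⟩ := mem_filter.1 hA
      have hdet := det_entries A
      have := (mem_gammaBox.1 (hS hAS)).1
      exact mem_factorPairs.2 ⟨this _ _, this _ _, by dsimp only; rw [← hSc A hAS]; linarith⟩
    · obtain ⟨hA, hAb⟩ := mem_filter.1 hA
      obtain ⟨hB, hBb⟩ := mem_filter.1 hB
      simp only [Prod.mk.injEq] at h
      exact sl2_ext h.1 (hAb.trans hBb.symm) ((hSc A hA).trans (hSc B hB).symm) h.2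
  set S : Finset (Matrix.SpecialLinearGroup (Fin 2) ℤ) := {A ∈ gammaBox N Q | A.1 1 0 = c}
  have hSsub : S ⊆ gammaBox N Q := filter_subset _ _
  have hSc : ∀ A ∈ S, A.1 1 0 = c := fun A hA ↦ (mem_filter.1 hA).2
  have h1 : #{A ∈ S | A.1 0 1 * c + 1 ≠ 0} ≤ D * #(Icc (-(N : ℤ)) N) := by
    refine card_le_mul_card_image_of_maps_to (f := fun A ↦ A.1 0 1) (fun A hA ↦ ?_) _
      fun b hb ↦ ?_
    · exact mem_Icc.2 (abs_le.1 ((mem_gammaBox.1 (hSsub (mem_filter.1 hA).1)).1 _ _))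
    · by_cases hbc : b * c + 1 = 0
      · rw [filter_filter, filter_eq_empty_iff.2]
        · exact Nat.zero_le _
        · rintro A - ⟨h, rfl⟩
          exact h hbc
      · exact (hfib _ ((filter_subset _ _).trans hSsub)
          (fun A hA ↦ hSc A (mem_filter.1 hA).1) b).trans
          (hD.2 _ hbc (abs_mul_add_le (abs_le.2 (mem_Icc.1 hb)) hcN (by simp)))
  have h2 : #{A ∈ S | ¬ A.1 0 1 * c + 1 ≠ 0} ≤ 6 * N := by
    rcases (filter (fun A ↦ ¬ A.1 0 1 * c + 1 ≠ 0) S).eq_empty_or_nonempty with h | ⟨B, hB⟩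
    · rw [h, card_empty]
      exact Nat.zero_le _
    have hB := not_not.1 (mem_filter.1 hB).2
    calc _ ≤ #{A ∈ S | A.1 0 1 = B.1 0 1} := by
          refine card_le_card fun A hA ↦ ?_
          obtain ⟨hA, hA'⟩ := mem_filter.1 hA
          refine mem_filter.2 ⟨hA, mul_right_cancel₀ hc ?_⟩
          linarith [not_not.1 hA']
      _ ≤ _ := hfib S hSsub hSc _
      _ ≤ 6 * N := by
          rw [hB]
          exact card_factorPairs_zero_le hN
  rw [← card_filter_add_card_filter_not (s := S) fun A ↦ A.1 0 1 * c + 1 ≠ 0]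
  calc _ ≤ D * (3 * N) + 6 * N := add_le_add (h1.trans (by gcongr; exact card_Icc_neg_le hN)) h2
    _ ≤ _ := by nlinarith [hD.1]

theorem card_collide_row_le {N Q : ℕ} (B : Matrix.SpecialLinearGroup (Fin 2) ℤ)
    (hB : B.1 1 0 ≠ 0) {c : ℤ} (hc : c ≠ 0) (hcN : |c| ≤ N) (hBc : |B.1 1 0| ≤ |c|) :
    #{A ∈ gammaBox N Q | A.1 1 0 = c ∧ Collide A B} * (B.1 1 0).natAbs ≤ 15 * N := by
  set S : Finset (Matrix.SpecialLinearGroup (Fin 2) ℤ) :=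
    {A ∈ gammaBox N Q | A.1 1 0 = c ∧ Collide A B}
  have hSmem : ∀ A ∈ S, A ∈ gammaBox N Q ∧ A.1 1 0 = c ∧ Collide A B := fun A hA ↦ mem_filter.1 hA
  have hB' : 1 ≤ (B.1 1 0).natAbs := Int.natAbs_pos.2 hB
  have hc' : 1 ≤ c.natAbs := Int.natAbs_pos.2 hc
  have hBc' : (B.1 1 0).natAbs ≤ c.natAbs := by zify; exact hBc
  have h1 : #S ≤ 3 * N / c.natAbs * #(S.image fun A ↦ A.1 1 1) := by
    refine card_le_mul_card_image _ _ fun d _ ↦ ?_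
    rw [Nat.le_div_iff_mul_le hc', ← card_image_of_injOn (f := fun A ↦ A.1 0 0)]
    · refine card_mul_le_of_dvd_sub hc' (by zify; exact hcN) ?_ ?_
      · intro x hx
        obtain ⟨A, hA, rfl⟩ := mem_image.1 hx
        exact (mem_gammaBox.1 (hSmem A (mem_filter.1 hA).1).1).1 _ _
      · intro x hx y hy
        have hdvd : ∀ z ∈ image (fun A ↦ A.1 0 0) (filter
            (fun A : Matrix.SpecialLinearGroup (Fin 2) ℤ ↦ A.1 1 1 = d) S),
            ((c.natAbs : ℕ) : ℤ) ∣ d * z - 1 := by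
          intro z hz
          obtain ⟨A, hA, rfl⟩ := mem_image.1 hz
          obtain ⟨hAS, rfl⟩ := mem_filter.1 hA
          rw [Int.natAbs_dvd, ← (hSmem A hAS).2.1]
          exact ⟨A.1 0 1, by linarith [det_entries A]⟩
        exact dvd_sub_of_dvd_mul_sub_one (hdvd x hx) (hdvd y hy)
    · intro A hA A' hA' h
      obtain ⟨hA, hd⟩ := mem_filter.1 hA
      obtain ⟨hA', hd'⟩ := mem_filter.1 hA'
      have hcA := (hSmem A hA).2.1
      have hcA' := (hSmem A' hA').2.1
      refine sl2_ext h (mul_right_cancel₀ hc ?_) (hcA.trans hcA'.symm) (hd.trans hd'.symm)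
      have e1 := det_entries A
      have e2 := det_entries A'
      dsimp only at h
      rw [h, hd, hcA] at e1
      rw [hd', hcA'] at e2
      linarith
  have h2 : #(S.image fun A ↦ A.1 1 1) ≤ 4 * c.natAbs / (B.1 1 0).natAbs + 1 := by
    refine card_le_of_sub_le fun x hx y hy ↦ ?_
    obtain ⟨A, hA, rfl⟩ := mem_image.1 hx
    obtain ⟨A', hA', rfl⟩ := mem_image.1 hy
    obtain ⟨-, hcA, hcol⟩ := hSmem A hA
    obtain ⟨-, hcA', hcol'⟩ := hSmem A' hA'
    rw [Collide, hcA] at hcol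
    rw [Collide, hcA'] at hcol'
    refine (le_abs_self _).trans ?_
    rw [← Int.natCast_natAbs]
    norm_cast
    rw [Nat.le_div_iff_mul_le hB', ← Int.natAbs_mul]
    zify
    calc |(A.1 1 1 - A'.1 1 1) * B.1 1 0|
        = |(c * B.1 1 1 - B.1 1 0 * A'.1 1 1) - (c * B.1 1 1 - B.1 1 0 * A.1 1 1)| := by
          congr 1
          ring
      _ ≤ |c * B.1 1 1 - B.1 1 0 * A'.1 1 1| + |c * B.1 1 1 - B.1 1 0 * A.1 1 1| := abs_sub _ _
      _ ≤ 4 * |c| := by linarith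
  calc #S * (B.1 1 0).natAbs
      ≤ 3 * N / c.natAbs * (4 * c.natAbs / (B.1 1 0).natAbs + 1) * (B.1 1 0).natAbs := by
        gcongr
        exact h1.trans (by gcongr)
    _ = 3 * N / c.natAbs * (4 * c.natAbs / (B.1 1 0).natAbs * (B.1 1 0).natAbs
          + (B.1 1 0).natAbs) := by ring
    _ ≤ 3 * N / c.natAbs * (4 * c.natAbs + c.natAbs) := by
        have := Nat.div_mul_le_self (4 * c.natAbs) (B.1 1 0).natAbs
        gcongr
    _ = 5 * (3 * N / c.natAbs * c.natAbs) := by ring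
    _ ≤ 5 * (3 * N) := Nat.mul_le_mul_left _ (Nat.div_mul_le_self _ _)
    _ = 15 * N := by ring

theorem card_collide_le {N Q : ℕ} (hQ : 1 ≤ Q) (hQN : Q ≤ N)
    (B : Matrix.SpecialLinearGroup (Fin 2) ℤ) (hB : B.1 1 0 ≠ 0) :
    #{A ∈ gammaBox N Q | A.1 1 0 ≠ 0 ∧ |B.1 1 0| ≤ |A.1 1 0| ∧ Collide A B} *
      (Q * (B.1 1 0).natAbs) ≤ 45 * N ^ 2 := by
  set S : Finset (Matrix.SpecialLinearGroup (Fin 2) ℤ) :=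
    {A ∈ gammaBox N Q | A.1 1 0 ≠ 0 ∧ |B.1 1 0| ≤ |A.1 1 0| ∧ Collide A B}
  have hB' : 1 ≤ (B.1 1 0).natAbs := Int.natAbs_pos.2 hB
  have h1 : #S ≤ 15 * N / (B.1 1 0).natAbs * #(S.image fun A ↦ A.1 1 0) := by
    refine card_le_mul_card_image _ _ fun c hc ↦ ?_
    obtain ⟨A, hA, rfl⟩ := mem_image.1 hc
    obtain ⟨hA, hA0, hAB, -⟩ := mem_filter.1 hA
    rw [Nat.le_div_iff_mul_le hB']
    refine le_trans ?_ (card_collide_row_le (Q := Q) B hB hA0 ((mem_gammaBox.1 hA).1 _ _) hAB)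
    gcongr
    intro A' hA'
    obtain ⟨hA', hcc⟩ := mem_filter.1 hA'
    obtain ⟨hA', -, -, hcol⟩ := mem_filter.1 hA'
    exact mem_filter.2 ⟨hA', hcc, hcol⟩
  have h2 : #(S.image fun A ↦ (A.1 1 0 : ℤ)) * Q ≤ 3 * N := by
    have hmem : ∀ x ∈ S.image fun A ↦ (A.1 1 0 : ℤ), |x| ≤ N ∧ (Q : ℤ) ∣ x := by
      intro x hx
      obtain ⟨A, hA, rfl⟩ := mem_image.1 hx
      have := mem_gammaBox.1 (mem_filter.1 hA).1
      exact ⟨this.1 _ _, this.2⟩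
    exact card_mul_le_of_dvd_sub hQ hQN (fun x hx ↦ (hmem x hx).1)
      fun x hx y hy ↦ dvd_sub (hmem x hx).2 (hmem y hy).2
  calc #S * (Q * (B.1 1 0).natAbs)
      ≤ 15 * N / (B.1 1 0).natAbs * #(S.image fun A ↦ A.1 1 0) * (Q * (B.1 1 0).natAbs) := by
        gcongr
    _ = 15 * N / (B.1 1 0).natAbs * (B.1 1 0).natAbs * (#(S.image fun A ↦ A.1 1 0) * Q) := by ring
    _ ≤ 15 * N * (3 * N) := Nat.mul_le_mul (Nat.div_mul_le_self _ _) h2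
    _ = _ := by ring

/-- The pairs in `gammaBox N Q` with nonzero lower left entries that collide. -/
noncomputable def collidingPairs (N Q : ℕ) :
    Finset (Matrix.SpecialLinearGroup (Fin 2) ℤ × Matrix.SpecialLinearGroup (Fin 2) ℤ) :=
  {p ∈ gammaBox N Q ×ˢ gammaBox N Q | p.1.1 1 0 ≠ 0 ∧ p.2.1 1 0 ≠ 0 ∧ Collide p.1 p.2}

theorem card_natAbs_lower_left_eq_le {N Q D k : ℕ} (hN : 1 ≤ N) (hD : FactorBound N D)
    (hk : 1 ≤ k) (hkN : k ≤ N) :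
    #{A ∈ gammaBox N Q | (A.1 1 0).natAbs = k} ≤ 18 * (N * D) := by
  calc _ ≤ #({A ∈ gammaBox N Q | A.1 1 0 = (k : ℤ)} ∪ {A ∈ gammaBox N Q | A.1 1 0 = -(k : ℤ)}) := by
        refine card_le_card fun A hA ↦ ?_
        obtain ⟨hA', rfl⟩ := mem_filter.1 hA
        simp only [mem_union, mem_filter, hA', true_and]
        exact Int.natAbs_eq _
    _ ≤ _ := card_union_le _ _
    _ ≤ 9 * (N * D) + 9 * (N * D) := by
        refine add_le_add (card_lower_left_eq_le hN hD (by omega) ?_)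
          (card_lower_left_eq_le hN hD (by omega) ?_)
        · simpa using hkN
        · simpa using hkN
    _ = _ := by ring

theorem card_ordered_collidingPairs_mul_le {N Q D : ℕ} (hN : 1 ≤ N) (hQ : 1 ≤ Q) (hQN : Q ≤ N)
    (hD : FactorBound N D) :
    (#{p ∈ collidingPairs N Q | |p.2.1 1 0| ≤ |p.1.1 1 0|} : ℝ) * Q ≤
      810 * (N ^ 3 * D * (harmonic N : ℝ)) := by
  have hQ0 : (0 : ℝ) < Q := by exact_mod_cast hQ
  set P := {p ∈ collidingPairs N Q | |p.2.1 1 0| ≤ |p.1.1 1 0|}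
  set T : Finset (Matrix.SpecialLinearGroup (Fin 2) ℤ) := {B ∈ gammaBox N Q | B.1 1 0 ≠ 0}
  have hmaps : ∀ p ∈ P, p.2 ∈ T := by
    intro p hp
    obtain ⟨hp, h⟩ := mem_filter.1 (mem_filter.1 hp).1
    exact mem_filter.2 ⟨(mem_product.1 hp).2, h.2.1⟩
  have hfib : ∀ B ∈ T, (#{p ∈ P | p.2 = B} : ℝ) * Q ≤ 45 * N ^ 2 / ((B.1 1 0).natAbs : ℝ) := by
    intro B hB
    have hB0 := (mem_filter.1 hB).2
    rw [le_div_iff₀ (by exact_mod_cast Int.natAbs_pos.2 hB0), mul_assoc]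
    have hle : #{p ∈ P | p.2 = B} ≤
        #{A ∈ gammaBox N Q | A.1 1 0 ≠ 0 ∧ |B.1 1 0| ≤ |A.1 1 0| ∧ Collide A B} := by
      refine card_le_card_of_injOn Prod.fst (fun p hp ↦ ?_) fun p hp q hq h ↦
        Prod.ext h ((mem_filter.1 hp).2.trans (mem_filter.1 hq).2.symm)
      obtain ⟨hpP, rfl⟩ := mem_filter.1 hp
      obtain ⟨hp1, hle⟩ := mem_filter.1 hpP
      obtain ⟨hp2, h⟩ := mem_filter.1 hp1
      exact mem_filter.2 ⟨(mem_product.1 hp2).1, h.1, hle, h.2.2⟩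
    exact_mod_cast (Nat.mul_le_mul_right _ hle).trans (card_collide_le hQ hQN B hB0)
  have hmapsT : ∀ B ∈ T, (B.1 1 0).natAbs ∈ Icc 1 N := by
    intro B hB
    obtain ⟨hB, hB0⟩ := mem_filter.1 hB
    refine mem_Icc.2 ⟨Int.natAbs_pos.2 hB0, ?_⟩
    zify
    exact (mem_gammaBox.1 hB).1 _ _
  calc (#P : ℝ) * Q = ∑ B ∈ T, (#{p ∈ P | p.2 = B} : ℝ) * Q := by
        rw [card_eq_sum_card_fiberwise hmaps, Nat.cast_sum, sum_mul]
    _ ≤ ∑ B ∈ T, 45 * N ^ 2 / ((B.1 1 0).natAbs : ℝ) := sum_le_sum hfib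
    _ = ∑ k ∈ Icc 1 N, ∑ B ∈ T with (B.1 1 0).natAbs = k, 45 * N ^ 2 / ((B.1 1 0).natAbs : ℝ) :=
        (sum_fiberwise_of_maps_to hmapsT _).symm
    _ = ∑ k ∈ Icc 1 N, (#{B ∈ T | (B.1 1 0).natAbs = k} : ℝ) * (45 * N ^ 2 / (k : ℝ)) := by
        refine sum_congr rfl fun k _ ↦ ?_
        rw [← nsmul_eq_mul, ← sum_const]
        exact sum_congr rfl fun B hB ↦ by rw [(mem_filter.1 hB).2]
    _ ≤ ∑ k ∈ Icc 1 N, (18 * (N * D) : ℝ) * (45 * N ^ 2 / (k : ℝ)) := by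
        refine sum_le_sum fun k hk ↦ ?_
        obtain ⟨hk, hkN⟩ := mem_Icc.1 hk
        gcongr
        exact_mod_cast (card_le_card (filter_subset_filter _ (filter_subset _ _))).trans
          (card_natAbs_lower_left_eq_le hN hD hk hkN)
    _ = _ := by
        rw [harmonic_eq_sum_Icc]
        push_cast
        simp_rw [mul_sum]
        exact sum_congr rfl fun k _ ↦ by ring

theorem card_collidingPairs_mul_le {N Q D : ℕ} (hN : 1 ≤ N) (hQ : 1 ≤ Q) (hQN : Q ≤ N)
    (hD : FactorBound N D) :
    (#(collidingPairs N Q) : ℝ) * Q ≤ 1620 * (N ^ 3 * D * (harmonic N : ℝ)) := by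
  have hsub : collidingPairs N Q ⊆ {p ∈ collidingPairs N Q | |p.2.1 1 0| ≤ |p.1.1 1 0|} ∪
      {p ∈ collidingPairs N Q | |p.2.1 1 0| ≤ |p.1.1 1 0|}.image Prod.swap := by
    intro p hp
    rw [mem_union]
    rcases le_total |p.2.1 1 0| |p.1.1 1 0| with h | h
    · exact Or.inl (mem_filter.2 ⟨hp, h⟩)
    · refine Or.inr (mem_image.2 ⟨p.swap, mem_filter.2 ⟨?_, h⟩, p.swap_swap⟩)
      obtain ⟨hp, h1, h2, h3⟩ := mem_filter.1 hp
      refine mem_filter.2 ⟨mem_product.2 (mem_product.1 hp).symm, h2, h1, ?_⟩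
      rw [Collide, abs_sub_comm, add_comm] at h3
      exact h3
  have hcard : #(collidingPairs N Q) ≤
      2 * #{p ∈ collidingPairs N Q | |p.2.1 1 0| ≤ |p.1.1 1 0|} := by
    refine (card_le_card hsub).trans ((card_union_le _ _).trans ?_)
    rw [two_mul]
    exact Nat.add_le_add_left card_image_le _
  have hcard' : (#(collidingPairs N Q) : ℝ) ≤
      2 * #{p ∈ collidingPairs N Q | |p.2.1 1 0| ≤ |p.1.1 1 0|} := by exact_mod_cast hcard
  nlinarith [card_ordered_collidingPairs_mul_le hN hQ hQN hD, (Nat.cast_nonneg Q : (0 : ℝ) ≤ Q)]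

theorem card_le_of_determines {α β : Type*} {s : ℕ} {G : Finset α}
    {S : Finset (Fin s → α)} (hS : ∀ f ∈ S, ∀ k, f k ∈ G) (I : Finset (Fin s))
    (φ : (Fin s → α) → β) {P : Finset β} (hφ : ∀ f ∈ S, φ f ∈ P)
    (hI : ∀ f ∈ S, ∀ g ∈ S, φ f = φ g → ∀ i ∈ I, f i = g i) :
    #S ≤ #P * #G ^ (s - #I) := by
  calc #S ≤ #(P ×ˢ Fintype.piFinset fun _ : {i // i ∉ I} ↦ G) := by
        refine card_le_card_of_injOn (fun f ↦ (φ f, fun i ↦ f i)) (fun f hf ↦ ?_)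
          fun f hf g hg h ↦ ?_
        · exact mem_product.2 ⟨hφ f hf, Fintype.mem_piFinset.2 fun i ↦ hS f hf i⟩
        · rw [Prod.mk.injEq] at h
          funext i
          by_cases hi : i ∈ I
          · exact hI f hf g hg h.1 i hi
          · exact congrFun h.2 ⟨i, hi⟩
    _ = _ := by simp [card_product, Fintype.card_piFinset]

theorem zpow_sign_injective {A B : Matrix.SpecialLinearGroup (Fin 2) ℤ} {e : ℤ}
    (he : e ∈ ({1, -1} : Finset ℤ)) (h : A ^ e = B ^ e) : A = B := by
  simp only [mem_insert, mem_singleton] at he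
  rcases he with rfl | rfl <;> simpa using h

theorem ncard_nonFree_le (s N Q : ℕ) :
    {A : Fin s → Matrix.SpecialLinearGroup (Fin 2) ℤ |
        (∀ k, A k ∈ gammaBox N Q) ∧ IsNonFreeTuple A}.ncard ≤
      s * (#{A ∈ gammaBox N Q | |A.1 0 0 + A.1 1 1| ≤ 2} * #(gammaBox N Q) ^ (s - 1)) +
        (s * s - s) * 4 * (#(collidingPairs N Q) * #(gammaBox N Q) ^ (s - 2)) := by
  set G := gammaBox N Q
  set F : Finset (Fin s → Matrix.SpecialLinearGroup (Fin 2) ℤ) := Fintype.piFinset fun _ ↦ G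
  set σ : Finset ℤ := {1, -1}
  set U := univ.biUnion fun k ↦ {A ∈ F | |(A k).1 0 0 + (A k).1 1 1| ≤ 2}
  set V := ((univ : Finset (Fin s)).offDiag ×ˢ (σ ×ˢ σ)).biUnion fun q ↦
    {A ∈ F | (A q.1.1 ^ q.2.1, A q.1.2 ^ q.2.2) ∈ collidingPairs N Q}
  have hFG : ∀ f ∈ F, ∀ k, f k ∈ G := fun f hf ↦ Fintype.mem_piFinset.1 hf
  have hsub : {A : Fin s → Matrix.SpecialLinearGroup (Fin 2) ℤ |
      (∀ k, A k ∈ G) ∧ IsNonFreeTuple A} ⊆ ((U ∪ V : Finset _) : Set _) := by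
    rintro A ⟨hA, hfree⟩
    have hAF : A ∈ F := Fintype.mem_piFinset.2 hA
    rw [mem_coe, mem_union]
    rcases hfree.exists_trace_or_collide with ⟨k, hk⟩ | ⟨i, j, hij, e, he, f, hf, h⟩
    · exact Or.inl (mem_biUnion.2 ⟨k, mem_univ _, mem_filter.2 ⟨hAF, hk⟩⟩)
    · refine Or.inr (mem_biUnion.2 ⟨((i, j), (e, f)), ?_, mem_filter.2 ⟨hAF, ?_⟩⟩)
      · simpa [hij] using ⟨he, hf⟩
      · exact mem_filter.2 ⟨mem_product.2 ⟨zpow_mem_gammaBox (hA i) he,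
          zpow_mem_gammaBox (hA j) hf⟩, h⟩
  have hUcard : #U ≤ s * (#{A ∈ G | |A.1 0 0 + A.1 1 1| ≤ 2} * #G ^ (s - 1)) := by
    refine (card_biUnion_le_card_mul _ _ _ fun k _ ↦ ?_).trans_eq (by rw [card_fin])
    exact card_le_of_determines (fun f hf ↦ hFG f (mem_filter.1 hf).1) {k} (fun f ↦ f k)
      (fun f hf ↦ mem_filter.2 ⟨hFG f (mem_filter.1 hf).1 k, (mem_filter.1 hf).2⟩)
      fun f _ g _ h i hi ↦ by rwa [mem_singleton.1 hi]
  have hVcard : #V ≤ (s * s - s) * 4 * (#(collidingPairs N Q) * #G ^ (s - 2)) := by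
    refine (card_biUnion_le_card_mul _ _ _ fun q hq ↦ ?_).trans_eq
      (by rw [card_product, card_product, offDiag_card, card_fin]; rfl)
    obtain ⟨hq1, hq2⟩ := mem_product.1 hq
    have hne := (mem_offDiag.1 hq1).2.2
    obtain ⟨he, hf⟩ := mem_product.1 hq2
    refine (card_le_of_determines (fun f hf ↦ hFG f (mem_filter.1 hf).1) {q.1.1, q.1.2}
      (fun A ↦ (A q.1.1 ^ q.2.1, A q.1.2 ^ q.2.2)) (fun f hf ↦ (mem_filter.1 hf).2)
      fun f _ g _ h i hi ↦ ?_).trans_eq (by rw [card_pair hne])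
    rw [Prod.mk.injEq] at h
    rw [mem_insert, mem_singleton] at hi
    rcases hi with rfl | rfl
    · exact zpow_sign_injective he h.1
    · exact zpow_sign_injective hf h.2
  calc _ ≤ ((U ∪ V : Finset _) : Set _).ncard := Set.ncard_le_ncard hsub (finite_toSet _)
    _ = #(U ∪ V) := Set.ncard_coe_finset _
    _ ≤ _ := (card_union_le _ _).trans (add_le_add hUcard hVcard)

/-- For every `η > 0` both the number of factorisations and the harmonic numbers up to `X` are
bounded by a constant times `X ^ η`. -/
theorem exists_factorBound {η : ℝ} (hη : 0 < η) :
    ∃ K : ℝ, 1 ≤ K ∧ ∀ X : ℝ, 1 ≤ X → ∃ D : ℕ, FactorBound ⌊X⌋₊ D ∧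
      1620 * (D : ℝ) ≤ K * X ^ η ∧ (harmonic ⌊X⌋₊ : ℝ) ≤ K * X ^ η := by
  obtain ⟨C, hC, hdiv⟩ := exists_card_divisors_le_rpow_s8 (half_pos hη)
  set a : ℝ := 2 * C * 2 ^ (η / 2)
  have ha : 1 ≤ a := by
    have : (1 : ℝ) ≤ 2 ^ (η / 2) := Real.one_le_rpow one_le_two (by positivity)
    nlinarith
  refine ⟨max (1620 * a) (1 + 1 / η), le_max_of_le_left (by linarith), fun X hX ↦ ?_⟩
  have hX0 : 0 ≤ X := by linarith
  have hXη : 1 ≤ X ^ η := Real.one_le_rpow hX hη.le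
  have hN : ((⌊X⌋₊ : ℕ) : ℝ) ≤ X := Nat.floor_le hX0
  have hN1 : 1 ≤ ⌊X⌋₊ := (Nat.one_le_floor_iff X).2 hX
  refine ⟨⌊a * X ^ η⌋₊, ⟨(Nat.one_le_floor_iff _).2 (by nlinarith), fun n hn hnN ↦ ?_⟩, ?_, ?_⟩
  · refine Nat.le_floor ?_
    have hnX : ((n.natAbs : ℕ) : ℝ) ≤ 2 * X ^ 2 := by
      have h1 : ((n.natAbs : ℕ) : ℝ) ≤ (⌊X⌋₊ : ℝ) ^ 2 + 1 := by
        rw [Nat.cast_natAbs]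
        exact_mod_cast hnN
      nlinarith [(Nat.cast_nonneg _ : (0 : ℝ) ≤ (⌊X⌋₊ : ℝ))]
    calc (#(factorPairs ⌊X⌋₊ n) : ℝ) ≤ 2 * #n.natAbs.divisors := by
          exact_mod_cast card_factorPairs_le hn
      _ ≤ 2 * (C * (n.natAbs : ℝ) ^ (η / 2)) := by
          gcongr
          exact hdiv _ (Int.natAbs_ne_zero.2 hn)
      _ ≤ 2 * (C * (2 * X ^ 2) ^ (η / 2)) := by gcongr
      _ = a * X ^ η := by
          rw [Real.mul_rpow zero_le_two (by positivity), ← Real.rpow_natCast X 2,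
            ← Real.rpow_mul hX0]
          simp only [a]
          rw [show ((2 : ℕ) : ℝ) * (η / 2) = η by push_cast; ring]
          ring
  · have h := Nat.floor_le (show 0 ≤ a * X ^ η by positivity)
    calc (1620 * (⌊a * X ^ η⌋₊ : ℝ)) ≤ 1620 * (a * X ^ η) := by gcongr
      _ = 1620 * a * X ^ η := by ring
      _ ≤ _ := by
        gcongr
        exact le_max_left _ _
  · calc (harmonic ⌊X⌋₊ : ℝ) ≤ 1 + Real.log ⌊X⌋₊ := harmonic_le_one_add_log _
      _ ≤ 1 + Real.log X := by gcongr
      _ ≤ X ^ η + X ^ η / η := add_le_add hXη (Real.log_le_rpow_div hX0 hη)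
      _ = (1 + 1 / η) * X ^ η := by ring
      _ ≤ _ := by
        gcongr
        exact le_max_right _ _

theorem ncard_nonFree_le_of_factorBound {n N Q D : ℕ} (hN : 1 ≤ N) (hQ : 1 ≤ Q) (hQN : Q ≤ N)
    (hD : FactorBound N D) {L : ℝ} (hDL : 1620 * (D : ℝ) ≤ L) (hHL : (harmonic N : ℝ) ≤ L) :
    ({A : Fin (n + 1) → Matrix.SpecialLinearGroup (Fin 2) ℤ |
        (∀ k, A k ∈ gammaBox N Q) ∧ IsNonFreeTuple A}.ncard : ℝ) ≤
      5 * (n + 1) ^ 2 * (L * N * (L * N ^ 2 / Q) ^ n) := by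
  have hQ0 : (0 : ℝ) < Q := by exact_mod_cast hQ
  have hD1 : (1 : ℝ) ≤ D := by exact_mod_cast hD.1
  have hL0 : 0 ≤ L := by linarith
  have hH0 : (0 : ℝ) ≤ harmonic N := by exact_mod_cast (harmonic_pos (by omega)).le
  set y : ℝ := L * N ^ 2 / Q with hy
  have hy0 : 0 ≤ y := by positivity
  have hT : (#{A ∈ gammaBox N Q | |A.1 0 0 + A.1 1 1| ≤ 2} : ℝ) ≤ L * N := by
    calc _ ≤ ((27 * (N * D) : ℕ) : ℝ) := by exact_mod_cast card_small_trace_le hN hD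
      _ = 27 * D * N := by push_cast; ring
      _ ≤ L * N := by gcongr; linarith
  have hG : (#(gammaBox N Q) : ℝ) ≤ y := by
    rw [hy, le_div_iff₀ hQ0]
    calc _ ≤ ((21 * (N ^ 2 * D) : ℕ) : ℝ) := by exact_mod_cast card_gammaBox_mul_le hN hQ hQN hD
      _ = 21 * D * N ^ 2 := by push_cast; ring
      _ ≤ L * N ^ 2 := by gcongr; linarith
  have hP : (#(collidingPairs N Q) : ℝ) ≤ L * N * y := by
    rw [hy, mul_div_assoc', le_div_iff₀ hQ0]
    calc _ ≤ 1620 * (N ^ 3 * D * (harmonic N : ℝ)) := card_collidingPairs_mul_le hN hQ hQN hD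
      _ = N ^ 3 * (1620 * D * (harmonic N : ℝ)) := by ring
      _ ≤ N ^ 3 * (L * L) := by gcongr
      _ = _ := by ring
  have hTG : (#{A ∈ gammaBox N Q | |A.1 0 0 + A.1 1 1| ≤ 2} : ℝ) * (#(gammaBox N Q) : ℝ) ^ n ≤
      L * N * y ^ n := by gcongr
  have hPG : (((n + 1) * (n + 1) - (n + 1) : ℕ) : ℝ) * 4 *
      ((#(collidingPairs N Q) : ℝ) * (#(gammaBox N Q) : ℝ) ^ (n + 1 - 2)) ≤
      4 * (n + 1) ^ 2 * (L * N * y ^ n) := by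
    rcases n with _ | n
    · norm_num
      positivity
    · have h1 : (((n + 1 + 1) * (n + 1 + 1) - (n + 1 + 1) : ℕ) : ℝ) ≤ ((n + 1 : ℕ) + 1) ^ 2 := by
        rw [pow_two]
        exact_mod_cast Nat.sub_le _ _
      rw [show n + 1 + 1 - 2 = n by omega]
      calc _ ≤ (((n + 1 : ℕ) : ℝ) + 1) ^ 2 * 4 * (L * N * y * y ^ n) := by gcongr
        _ = _ := by ring
  have h := ncard_nonFree_le (n + 1) N Q
  rw [Nat.add_sub_cancel] at h
  calc _ ≤ _ := Nat.cast_le.2 h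
    _ ≤ (n + 1) * (L * N * y ^ n) + 4 * (n + 1) ^ 2 * (L * N * y ^ n) := by
        rw [Nat.cast_add]
        refine add_le_add ?_ ?_
        · push_cast
          gcongr
        · exact_mod_cast hPG
    _ ≤ (n + 1) ^ 2 * (L * N * y ^ n) + 4 * (n + 1) ^ 2 * (L * N * y ^ n) := by
        gcongr
        nlinarith [(Nat.cast_nonneg n : (0 : ℝ) ≤ n)]
    _ = _ := by ring

/-- for every `ε > 0` and `s ≥ 1` there is `C(ε, s)` such that for `X ≥ 2`
and integers `1 ≤ Q ≤ X`, the number of `s`-tuples in `Γ₀(Q)` of height at most `X`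
that do not freely generate a free subgroup is at most `C(ε,s) · X^{2s-1+ε} · Q^{1-s}`. -/
theorem stmt8 (ε : ℝ) (hε : 0 < ε) (s : ℕ) (hs : 1 ≤ s) :
    ∃ C : ℝ, 0 < C ∧ ∀ (X : ℝ) (Q : ℤ), 2 ≤ X → 1 ≤ Q → (Q : ℝ) ≤ X →
      ({A : Fin s → Matrix.SpecialLinearGroup (Fin 2) ℤ |
          (∀ k, ∀ i j, (|(A k).1 i j| : ℝ) ≤ X) ∧
          (∀ k, Q ∣ (A k).1 1 0) ∧
          IsNonFreeTuple A}.ncard : ℝ)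
        ≤ C * X ^ (2 * (s : ℝ) - 1 + ε) * (Q : ℝ) ^ (-(s : ℝ) + 1) := by
  obtain ⟨n, rfl⟩ : ∃ n, s = n + 1 := ⟨s - 1, by omega⟩
  have hn : (0 : ℝ) < n + 1 := by positivity
  obtain ⟨K, hK, hbound⟩ := exists_factorBound (div_pos hε hn)
  refine ⟨5 * (n + 1) ^ 2 * K ^ (n + 1), by positivity, fun X Q hX hQ hQX ↦ ?_⟩
  obtain ⟨q, rfl⟩ := Int.eq_ofNat_of_zero_le (zero_le_one.trans hQ)
  have hX0 : 0 < X := by linarith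
  have hq : 1 ≤ q := by exact_mod_cast hQ
  have hq0 : (0 : ℝ) < q := by exact_mod_cast hq
  obtain ⟨D, hD, hDL, hHL⟩ := hbound X (by linarith)
  have h := ncard_nonFree_le_of_factorBound (n := n) ((Nat.one_le_floor_iff X).2 (by linarith)) hq
    (Nat.le_floor hQX) hD hDL hHL
  have hset : {A : Fin (n + 1) → Matrix.SpecialLinearGroup (Fin 2) ℤ |
      (∀ k, ∀ i j, (|(A k).1 i j| : ℝ) ≤ X) ∧ (∀ k, (q : ℤ) ∣ (A k).1 1 0) ∧ IsNonFreeTuple A} =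
      {A | (∀ k, A k ∈ gammaBox ⌊X⌋₊ q) ∧ IsNonFreeTuple A} := by
    ext A
    have hfl : ∀ z : ℤ, (|(z : ℝ)| ≤ X ↔ |z| ≤ (⌊X⌋₊ : ℤ)) := fun z ↦ by
      rw [Int.natCast_floor_eq_floor hX0.le, Int.le_floor, Int.cast_abs]
    simp only [Set.mem_ofPred_eq, mem_gammaBox, hfl, forall_and, and_assoc]
  rw [hset]
  refine h.trans ?_
  set L := K * X ^ (ε / (n + 1 : ℝ)) with hL
  have hL0 : 0 ≤ L := by positivity
  have hNX : (⌊X⌋₊ : ℝ) ≤ X := Nat.floor_le hX0.le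
  have hLpow : L ^ (n + 1) = K ^ (n + 1) * X ^ ε := by
    rw [hL, mul_pow, ← Real.rpow_natCast (X ^ _), ← Real.rpow_mul hX0.le]
    congr 2
    push_cast
    field_simp
  have hXpow : X ^ (2 * ((n + 1 : ℕ) : ℝ) - 1 + ε) = X ^ (2 * n + 1) * X ^ ε := by
    rw [Real.rpow_add hX0, ← Real.rpow_natCast]
    congr 2
    push_cast
    ring
  have hqpow : (((q : ℕ) : ℤ) : ℝ) ^ (-((n + 1 : ℕ) : ℝ) + 1) = ((q : ℝ) ^ n)⁻¹ := by
    rw [← Real.rpow_natCast, ← Real.rpow_neg hq0.le, Int.cast_natCast]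
    congr 1
    push_cast
    ring
  rw [hXpow, hqpow]
  calc 5 * ((n : ℝ) + 1) ^ 2 * (L * ⌊X⌋₊ * (L * ⌊X⌋₊ ^ 2 / q) ^ n)
      ≤ 5 * ((n : ℝ) + 1) ^ 2 * (L * X * (L * X ^ 2 / q) ^ n) := by gcongr
    _ = 5 * ((n : ℝ) + 1) ^ 2 * (L ^ (n + 1) * X ^ (2 * n + 1) * ((q : ℝ) ^ n)⁻¹) := by
        rw [div_pow, mul_pow]
        ring
    _ = _ := by
        rw [hLpow]
        ring
end

section
/- For every ε > 0 there is a constant C(ε) such that for all reals Q, Y, X with 1 ≤ Q ≤ Y ≤ X, the number of pairs (A₁, A₂) of matrices in SL₂(ℤ) with heights at most X, lower-left entries c₁, c₂ nonzero and divisible by Q, satisfying Y/2 < min(|c₁|,|c₂|) ≤ Y and |d₁/c₁ - d₂/c₂| ≤ 1/|c₁| + 1/|c₂|, is at most C(ε) · X^{3+ε} / Q². -/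
/-- The integers `a` of absolute value at most `N` that are inverse to `d` modulo `c`. -/
noncomputable def boundedInverses (N c d : ℤ) : Finset ℤ :=
  (Finset.Icc (-N) N).filter fun a => c ∣ a * d - 1

lemma card_boundedInverses_le {N c d : ℤ} (hc : c ≠ 0) (hcN : |c| ≤ N) :
    ((boundedInverses N c d).card : ℝ) ≤ 4 * N / |(c : ℝ)| := by
  have hc' : 0 < |c| := abs_pos.mpr hc
  have hcR : (0 : ℝ) < |(c : ℝ)| := by exact_mod_cast hc'
  have hcard : (boundedInverses N c d).card ≤ (Finset.Icc ((-N) / |c|) (N / |c|)).card := by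
    refine Finset.card_le_card_of_injOn (fun a => a / |c|) ?_ ?_
    · intro a ha
      simp only [boundedInverses, Finset.coe_filter, Finset.mem_Icc, Set.mem_ofPred_eq] at ha
      simp only [Finset.coe_Icc, Set.mem_Icc]
      exact ⟨Int.ediv_le_ediv hc' ha.1.1, Int.ediv_le_ediv hc' ha.1.2⟩
    · intro a ha a' ha' h
      simp only [boundedInverses, Finset.coe_filter, Finset.mem_Icc, Set.mem_ofPred_eq] at ha ha'
      have hcop : IsCoprime c d := by
        obtain ⟨k, hk⟩ := ha.2
        exact ⟨-k, a, by linarith⟩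
      have hdvd : c ∣ a - a' := by
        refine hcop.dvd_of_dvd_mul_right ?_
        have := dvd_sub ha.2 ha'.2
        rwa [show a * d - 1 - (a' * d - 1) = (a - a') * d by ring] at this
      have hmod : a % |c| = a' % |c| :=
        (Int.modEq_iff_dvd.mpr ((abs_dvd _ _).mpr hdvd)).symm
      have h1 := Int.emod_add_mul_ediv a |c|
      have h2 := Int.emod_add_mul_ediv a' |c|
      simp only at h
      rw [← h1, ← h2, h, hmod]
  have hle : (-N) / |c| ≤ N / |c| + 1 := by
    have : (-N) / |c| ≤ N / |c| := Int.ediv_le_ediv hc' (by linarith)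
    linarith
  have hcardR : ((boundedInverses N c d).card : ℝ) ≤
      ((N / |c| + 1 - (-N) / |c| : ℤ) : ℝ) := by
    have := Int.card_Icc_of_le _ _ hle
    rw [← this]
    exact_mod_cast hcard
  have hup : ((N / |c| : ℤ) : ℝ) ≤ N / |(c : ℝ)| := by
    rw [le_div_iff₀ hcR]
    exact_mod_cast Int.ediv_mul_le N hc'.ne'
  have hlo : -(N / |(c : ℝ)|) - 1 ≤ (((-N) / |c| : ℤ) : ℝ) := by
    have h : -N < ((-N) / |c| + 1) * |c| := Int.lt_ediv_add_one_mul_self _ hc'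
    have h' : -(N : ℝ) < (((-N) / |c| : ℤ) + 1) * |(c : ℝ)| := by exact_mod_cast h
    have := (div_lt_iff₀ hcR).mpr h'
    rw [neg_div] at this
    linarith
  have hone : 1 ≤ N / |(c : ℝ)| := by
    rw [le_div_iff₀ hcR, one_mul]
    exact_mod_cast hcN
  have hfour : 4 * N / |(c : ℝ)| = 4 * (N / |(c : ℝ)|) := by ring
  push_cast at hcardR
  rw [hfour]
  linarith

open Classical in
/-- The pairs of integers of absolute value at most `N` giving close fractions with
denominators `c₁` and `c₂`. -/
noncomputable def closeNumerators (N c₁ c₂ : ℤ) : Finset (ℤ × ℤ) :=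
  (Finset.Icc (-N) N ×ˢ Finset.Icc (-N) N).filter fun d =>
    |(d.1 : ℝ) / (c₁ : ℝ) - (d.2 : ℝ) / (c₂ : ℝ)| ≤ 1 / |(c₁ : ℝ)| + 1 / |(c₂ : ℝ)|

lemma card_closeNumerators_comm (N c₁ c₂ : ℤ) :
    (closeNumerators N c₁ c₂).card = (closeNumerators N c₂ c₁).card := by
  refine Finset.card_bij (fun d _ => d.swap) ?_ (fun _ _ _ _ h => Prod.swap_injective h) ?_
  · intro d hd
    simp only [closeNumerators, Finset.mem_filter, Finset.mem_product] at hd ⊢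
    refine ⟨⟨hd.1.2, hd.1.1⟩, ?_⟩
    rw [abs_sub_comm, add_comm]
    exact hd.2
  · intro d hd
    refine ⟨d.swap, ?_, Prod.swap_swap d⟩
    simp only [closeNumerators, Finset.mem_filter, Finset.mem_product] at hd ⊢
    refine ⟨⟨hd.1.2, hd.1.1⟩, ?_⟩
    rw [abs_sub_comm, add_comm]
    exact hd.2

lemma card_closeNumerators_le_of_le {N c₁ c₂ : ℤ} (hN : 1 ≤ N) (h₁ : c₁ ≠ 0)
    (h : |c₁| ≤ |c₂|) : ((closeNumerators N c₁ c₂).card : ℝ) ≤ 18 * N := by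
  have hc : (0 : ℝ) < |(c₁ : ℝ)| := by exact_mod_cast abs_pos.mpr h₁
  have hcard : (closeNumerators N c₁ c₂).card ≤
      (Finset.Icc (-N) N ×ˢ Finset.Icc (-2 : ℤ) 3).card := by
    refine Finset.card_le_card_of_injOn
      (fun d => (d.2, d.1 - ⌊(c₁ : ℝ) * (d.2 / c₂)⌋)) ?_ ?_
    · rintro ⟨d₁, d₂⟩ hd
      simp only [closeNumerators, Finset.coe_filter, Finset.mem_product, Set.mem_ofPred_eq] at hd
      have hle : 1 / |(c₂ : ℝ)| ≤ 1 / |(c₁ : ℝ)| :=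
        one_div_le_one_div_of_le hc (by exact_mod_cast h)
      have hclose : |(d₁ : ℝ) - c₁ * (d₂ / c₂)| ≤ 2 := by
        have heq : (d₁ : ℝ) - c₁ * (d₂ / c₂) = c₁ * (d₁ / c₁ - d₂ / c₂) := by
          have : (c₁ : ℝ) ≠ 0 := by exact_mod_cast h₁
          rw [mul_sub, mul_div_cancel₀ _ this]
        rw [heq, abs_mul]
        calc |(c₁ : ℝ)| * |(d₁ : ℝ) / c₁ - d₂ / c₂|
            ≤ |(c₁ : ℝ)| * (1 / |(c₁ : ℝ)| + 1 / |(c₁ : ℝ)|) := by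
              gcongr
              linarith [hd.2]
          _ = 2 := by field_simp; norm_num
      obtain ⟨hl, hu⟩ := abs_le.mp hclose
      have hf := Int.floor_le ((c₁ : ℝ) * (d₂ / c₂))
      have hf' := Int.lt_floor_add_one ((c₁ : ℝ) * (d₂ / c₂))
      simp only [Finset.coe_product, Set.mem_prod, Finset.mem_coe]
      refine ⟨hd.1.2, Finset.mem_Icc.mpr ⟨?_, ?_⟩⟩
      · have : (-2 : ℝ) ≤ d₁ - ⌊(c₁ : ℝ) * (d₂ / c₂)⌋ := by linarith
        exact_mod_cast this
      · have : (d₁ : ℝ) - ⌊(c₁ : ℝ) * (d₂ / c₂)⌋ ≤ 3 := by linarith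
        exact_mod_cast this
    · rintro ⟨d₁, d₂⟩ _ ⟨d₁', d₂'⟩ _ h
      simp only [Prod.mk.injEq] at h
      obtain ⟨rfl, h⟩ := h
      simpa using h
  have hIcc : ((Finset.Icc (-N) N).card : ℤ) = N + 1 - -N :=
    Int.card_Icc_of_le _ _ (by linarith)
  rw [Finset.card_product] at hcard
  have h6 : (Finset.Icc (-2 : ℤ) 3).card = 6 := rfl
  rw [h6] at hcard
  have : ((closeNumerators N c₁ c₂).card : ℤ) ≤ 18 * N := by
    zify at hcard
    linarith
  exact_mod_cast this

lemma card_closeNumerators_le {N c₁ c₂ : ℤ} (hN : 1 ≤ N) (h₁ : c₁ ≠ 0) (h₂ : c₂ ≠ 0) :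
    ((closeNumerators N c₁ c₂).card : ℝ) ≤ 18 * N := by
  rcases le_total |c₁| |c₂| with h | h
  · exact card_closeNumerators_le_of_le hN h₁ h
  · rw [card_closeNumerators_comm]
    exact card_closeNumerators_le_of_le hN h₂ h

/-- The nonzero multiples of `Q` of absolute value at most `N`. -/
noncomputable def nonzeroMultiples (Q N : ℤ) : Finset ℤ :=
  (Finset.Icc (-N) N).filter fun c => c ≠ 0 ∧ Q ∣ c

lemma sum_inv_abs_nonzeroMultiples_le {Q : ℤ} (hQ : 1 ≤ Q) (N : ℕ) :
    ∑ c ∈ nonzeroMultiples Q N, |(c : ℝ)|⁻¹ ≤ 2 / Q * (1 + Real.log N) := by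
  have hQ0 : (0 : ℝ) < Q := by exact_mod_cast hQ
  set f : ℕ × Bool → ℤ := fun p => if p.2 then Q * (p.1 + 1) else -(Q * (p.1 + 1)) with hf
  have hsub : nonzeroMultiples Q N ⊆ (Finset.range N ×ˢ Finset.univ).image f := by
    intro c hc
    simp only [nonzeroMultiples, Finset.mem_filter, Finset.mem_Icc] at hc
    obtain ⟨⟨hl, hu⟩, h0, k, rfl⟩ := hc
    have hk0 : k ≠ 0 := by rintro rfl; simp at h0
    simp only [Finset.mem_image, Finset.mem_product, Finset.mem_range, Finset.mem_univ,
      and_true, Prod.exists, hf]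
    rcases lt_or_gt_of_ne hk0 with hk | hk
    · refine ⟨(-k - 1).toNat, false, ?_, ?_⟩
      · have : -k ≤ N := by nlinarith
        omega
      · rw [Int.toNat_of_nonneg (by omega)]
        simp
    · refine ⟨(k - 1).toNat, true, ?_, ?_⟩
      · have : k ≤ N := by nlinarith
        omega
      · rw [Int.toNat_of_nonneg (by omega)]
        simp
  have hval : ∀ p : ℕ × Bool, |(f p : ℝ)|⁻¹ = (Q : ℝ)⁻¹ * ((p.1 : ℝ) + 1)⁻¹ := by
    rintro ⟨n, b⟩
    have : (0 : ℝ) < Q * (n + 1) := by positivity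
    rw [← mul_inv]
    congr 1
    cases b <;> simp only [hf, if_true, Bool.false_eq_true, if_false] <;> push_cast <;>
      simp only [abs_neg, abs_of_pos this]
  calc ∑ c ∈ nonzeroMultiples Q N, |(c : ℝ)|⁻¹
      ≤ ∑ c ∈ (Finset.range N ×ˢ Finset.univ).image f, |(c : ℝ)|⁻¹ :=
        Finset.sum_le_sum_of_subset_of_nonneg hsub fun _ _ _ => by positivity
    _ ≤ ∑ p ∈ Finset.range N ×ˢ (Finset.univ : Finset Bool), |(f p : ℝ)|⁻¹ :=
        Finset.sum_image_le_of_nonneg fun _ _ => by positivity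
    _ = 2 / Q * (harmonic N : ℚ) := by
        simp only [hval, Finset.sum_product, Finset.sum_const, Finset.card_univ,
          Fintype.card_bool, harmonic]
        push_cast
        rw [Finset.mul_sum]
        refine Finset.sum_congr rfl fun n _ => ?_
        rw [nsmul_eq_mul]
        push_cast
        ring
    _ ≤ 2 / Q * (1 + Real.log N) := by
        gcongr
        exact harmonic_le_one_add_log N

/-- A finite set containing all pairs of matrices of determinant one with entries bounded by `N`,
lower-left entries nonzero and divisible by `Q`, and close ratios `d / c`. -/
noncomputable def closePairs (Q N : ℤ) : Finset ((ℤ × ℤ × ℤ × ℤ) × (ℤ × ℤ × ℤ × ℤ)) :=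
  (nonzeroMultiples Q N ×ˢ nonzeroMultiples Q N).biUnion fun c =>
    (closeNumerators N c.1 c.2).biUnion fun d =>
      (boundedInverses N c.1 d.1 ×ˢ boundedInverses N c.2 d.2).image fun a =>
        ((a.1, (a.1 * d.1 - 1) / c.1, c.1, d.1), (a.2, (a.2 * d.2 - 1) / c.2, c.2, d.2))

lemma card_closePairs_le {Q N : ℤ} (hN : 1 ≤ N) :
    ((closePairs Q N).card : ℝ) ≤
      288 * (N : ℝ) ^ 3 * (∑ c ∈ nonzeroMultiples Q N, |(c : ℝ)|⁻¹) ^ 2 := by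
  have hN0 : (0 : ℝ) ≤ N := by exact_mod_cast (by linarith : 0 ≤ N)
  have hmem : ∀ c ∈ nonzeroMultiples Q N, c ≠ 0 ∧ |c| ≤ N := by
    intro c hc
    simp only [nonzeroMultiples, Finset.mem_filter, Finset.mem_Icc] at hc
    exact ⟨hc.2.1, abs_le.mpr hc.1⟩
  have hcard : (closePairs Q N).card ≤
      ∑ c ∈ nonzeroMultiples Q N ×ˢ nonzeroMultiples Q N, ∑ d ∈ closeNumerators N c.1 c.2,
        (boundedInverses N c.1 d.1).card * (boundedInverses N c.2 d.2).card := by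
    refine Finset.card_biUnion_le.trans (Finset.sum_le_sum fun c _ => ?_)
    refine Finset.card_biUnion_le.trans (Finset.sum_le_sum fun d _ => ?_)
    exact Finset.card_image_le.trans (Finset.card_product _ _).le
  calc ((closePairs Q N).card : ℝ)
      ≤ ∑ c ∈ nonzeroMultiples Q N ×ˢ nonzeroMultiples Q N, ∑ d ∈ closeNumerators N c.1 c.2,
        ((boundedInverses N c.1 d.1).card : ℝ) * (boundedInverses N c.2 d.2).card := by
        exact_mod_cast hcard
    _ ≤ ∑ c ∈ nonzeroMultiples Q N ×ˢ nonzeroMultiples Q N,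
        18 * N * ((4 * N / |(c.1 : ℝ)|) * (4 * N / |(c.2 : ℝ)|)) := by
        refine Finset.sum_le_sum fun c hc => ?_
        obtain ⟨h₁, h₂⟩ := Finset.mem_product.mp hc
        obtain ⟨h₁, h₁'⟩ := hmem _ h₁
        obtain ⟨h₂, h₂'⟩ := hmem _ h₂
        calc ∑ d ∈ closeNumerators N c.1 c.2,
              ((boundedInverses N c.1 d.1).card : ℝ) * (boundedInverses N c.2 d.2).card
            ≤ ∑ _d ∈ closeNumerators N c.1 c.2,
              (4 * N / |(c.1 : ℝ)|) * (4 * N / |(c.2 : ℝ)|) :=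
              Finset.sum_le_sum fun d _ => mul_le_mul (card_boundedInverses_le h₁ h₁')
                (card_boundedInverses_le h₂ h₂') (by positivity) (by positivity)
          _ ≤ _ := by
              rw [Finset.sum_const, nsmul_eq_mul]
              gcongr
              exact card_closeNumerators_le hN h₁ h₂
    _ = _ := by
        rw [sq, Finset.sum_mul_sum, ← Finset.sum_product', Finset.mul_sum]
        refine Finset.sum_congr rfl fun c _ => ?_
        ring

lemma one_add_log_le_rpow {X δ : ℝ} (hX : 1 ≤ X) (hδ : 0 < δ) :
    1 + Real.log X ≤ (1 + 1 / δ) * X ^ δ := by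
  have h₁ := Real.log_le_rpow_div (zero_le_one.trans hX) hδ
  have h₂ := Real.one_le_rpow hX hδ.le
  calc 1 + Real.log X ≤ X ^ δ + X ^ δ / δ := add_le_add h₂ h₁
    _ = (1 + 1 / δ) * X ^ δ := by ring


/-- for every `ε > 0` there is `C(ε)` such that for `1 ≤ Q ≤ Y ≤ X`, the
number of pairs `(A₁, A₂) ∈ SL₂(ℤ)²` of height at most `X` with `c₁, c₂` nonzero,
divisible by `Q`, `Y/2 < min(|c₁|,|c₂|) ≤ Y` and `|d₁/c₁ - d₂/c₂| ≤ 1/|c₁| + 1/|c₂|`,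
is at most `C(ε) · X^{3+ε} / Q²`. -/
theorem stmt17 (ε : ℝ) (hε : 0 < ε) :
    ∃ C : ℝ, 0 < C ∧ ∀ (Q : ℤ) (Y X : ℝ), 1 ≤ Q → (Q : ℝ) ≤ Y → Y ≤ X →
      ({q : (ℤ × ℤ × ℤ × ℤ) × (ℤ × ℤ × ℤ × ℤ) |
          let a₁ := q.1.1; let b₁ := q.1.2.1; let c₁ := q.1.2.2.1; let d₁ := q.1.2.2.2
          let a₂ := q.2.1; let b₂ := q.2.2.1; let c₂ := q.2.2.2.1; let d₂ := q.2.2.2.2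
          a₁ * d₁ - b₁ * c₁ = 1 ∧ a₂ * d₂ - b₂ * c₂ = 1 ∧
          (|a₁| : ℝ) ≤ X ∧ (|b₁| : ℝ) ≤ X ∧ (|c₁| : ℝ) ≤ X ∧ (|d₁| : ℝ) ≤ X ∧
          (|a₂| : ℝ) ≤ X ∧ (|b₂| : ℝ) ≤ X ∧ (|c₂| : ℝ) ≤ X ∧ (|d₂| : ℝ) ≤ X ∧
          c₁ ≠ 0 ∧ c₂ ≠ 0 ∧ Q ∣ c₁ ∧ Q ∣ c₂ ∧
          Y / 2 < (min |c₁| |c₂| : ℝ) ∧ (min |c₁| |c₂| : ℝ) ≤ Y ∧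
          |(d₁ : ℝ) / (c₁ : ℝ) - (d₂ : ℝ) / (c₂ : ℝ)| ≤ 1 / (|c₁| : ℝ) + 1 / (|c₂| : ℝ)
          }.ncard : ℝ)
        ≤ C * X ^ (3 + ε) / (Q : ℝ) ^ 2 := by
  refine ⟨1152 * (1 + 1 / (ε / 2)) ^ 2, by positivity, fun Q Y X hQ hQY hYX => ?_⟩
  have hQR : (1 : ℝ) ≤ Q := by exact_mod_cast hQ
  have hX : 1 ≤ X := by linarith
  have hX0 : 0 < X := by linarith
  set N : ℕ := ⌊X⌋₊ with hN
  have hN1 : 1 ≤ N := Nat.le_floor (by exact_mod_cast hX)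
  have hNX : (N : ℝ) ≤ X := Nat.floor_le hX0.le
  have hbound : ∀ x : ℤ, |(x : ℝ)| ≤ X → x ∈ Finset.Icc (-(N : ℤ)) N := by
    intro x hx
    rw [Finset.mem_Icc, ← abs_le, Int.abs_eq_natAbs]
    refine Int.ofNat_le.mpr (Nat.le_floor ?_)
    rwa [Nat.cast_natAbs, Int.cast_abs]
  have hdet : ∀ a b c d : ℤ, c ≠ 0 → a * d - b * c = 1 →
      c ∣ a * d - 1 ∧ (a * d - 1) / c = b := by
    intro a b c d hc h
    have : a * d - 1 = c * b := by linarith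
    exact ⟨⟨b, this⟩, by rw [this, Int.mul_ediv_cancel_left _ hc]⟩
  refine (Nat.cast_le.mpr ((Set.ncard_le_ncard (t := ↑(closePairs Q N)) ?_
    (Finset.finite_toSet _)).trans (Set.ncard_coe_finset _).le)).trans ?_
  · rintro ⟨⟨a₁, b₁, c₁, d₁⟩, ⟨a₂, b₂, c₂, d₂⟩⟩ h
    obtain ⟨det₁, det₂, ha₁, -, hc₁, hd₁, ha₂, -, hc₂, hd₂, h₁, h₂, hQ₁, hQ₂, -, -, hclose⟩ := h
    obtain ⟨dvd₁, hb₁⟩ := hdet _ _ _ _ h₁ det₁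
    obtain ⟨dvd₂, hb₂⟩ := hdet _ _ _ _ h₂ det₂
    refine Finset.mem_coe.mpr (Finset.mem_biUnion.mpr ⟨(c₁, c₂), Finset.mem_product.mpr
      ⟨Finset.mem_filter.mpr ⟨hbound _ hc₁, h₁, hQ₁⟩,
        Finset.mem_filter.mpr ⟨hbound _ hc₂, h₂, hQ₂⟩⟩,
      Finset.mem_biUnion.mpr ⟨(d₁, d₂), Finset.mem_filter.mpr
        ⟨Finset.mem_product.mpr ⟨hbound _ hd₁, hbound _ hd₂⟩, hclose⟩,
      Finset.mem_image.mpr ⟨(a₁, a₂), Finset.mem_product.mpr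
        ⟨Finset.mem_filter.mpr ⟨hbound _ ha₁, dvd₁⟩,
          Finset.mem_filter.mpr ⟨hbound _ ha₂, dvd₂⟩⟩, ?_⟩⟩⟩)
    simp only [hb₁, hb₂]
  · have hsum : ∑ c ∈ nonzeroMultiples Q N, |(c : ℝ)|⁻¹ ≤
        2 / Q * ((1 + 1 / (ε / 2)) * X ^ (ε / 2)) := by
      refine (sum_inv_abs_nonzeroMultiples_le hQ N).trans ?_
      gcongr
      refine le_trans ?_ (one_add_log_le_rpow hX (half_pos hε))
      gcongr
    have hpow : X ^ (3 + ε) = X ^ 3 * (X ^ (ε / 2)) ^ 2 := by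
      rw [Real.rpow_add hX0, ← Real.rpow_mul_natCast hX0.le]
      norm_num
    calc ((closePairs Q N).card : ℝ)
        ≤ 288 * ((N : ℤ) : ℝ) ^ 3 * (∑ c ∈ nonzeroMultiples Q N, |(c : ℝ)|⁻¹) ^ 2 :=
          card_closePairs_le (by exact_mod_cast hN1)
      _ ≤ 288 * X ^ 3 * (2 / Q * ((1 + 1 / (ε / 2)) * X ^ (ε / 2))) ^ 2 := by
          rw [Int.cast_natCast]
          gcongr
      _ = 1152 * (1 + 1 / (ε / 2)) ^ 2 * X ^ (3 + ε) / (Q : ℝ) ^ 2 := by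
          rw [hpow]
          ring
end
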